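/- Let K be a field, q ∈ K nonzero, and n > t positive integers, with Ĩ := {n−t+1,…,n} and J̃ := {1,…,t}. Then: (a) a K-basis of the ideal ⟨d_Y⟩ of O_q(M_{n,t}) consists of all products [T|T'] where (T,T') is a preferred bitableau with first row (Ĩ, J̃); (b) a K-basis of the ideal ⟨d_Z⟩ of O_q(M_{t,n}) consists of all [T|T'] where (T,T') is a preferred bitableau with first row (J̃, J̃); (c) a K-basis of the ideal ⟨d_Y ⊗ d_Z⟩ of O_q(V) consists of all pure tensors [S|S'] ⊗ [T|T'] where (S,S') and (T,T') are preferred bitableaux with first rows (Ĩ, J̃) and (J̃, J̃) respectively; (d) a K-basis of the ideal ⟨d_x⟩ of O_q(M_n^{≤t}) consists of all cosets of [T|T'] where (T,T') is a preferred bitableau with first row (Ĩ, J̃). -/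

import Mathlib

open scoped TensorProduct

noncomputable section

/-- The four defining relations of the quantized coordinate ring `O_q(M_{u,v})`, as a relation
on the free algebra on generators `X_{ij}`, `(i,j) ∈ Fin u × Fin v`. -/
inductive QMRel (K : Type) [Field K] (q : K) (u v : ℕ) :
    FreeAlgebra K (Fin u × Fin v) → FreeAlgebra K (Fin u × Fin v) → Prop
  | row {i : Fin u} {j k : Fin v} (h : j < k) :
      QMRel K q u v (FreeAlgebra.ι K (i, j) * FreeAlgebra.ι K (i, k))
        (q • (FreeAlgebra.ι K (i, k) * FreeAlgebra.ι K (i, j)))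
  | col {i k : Fin u} {j : Fin v} (h : i < k) :
      QMRel K q u v (FreeAlgebra.ι K (i, j) * FreeAlgebra.ι K (k, j))
        (q • (FreeAlgebra.ι K (k, j) * FreeAlgebra.ι K (i, j)))
  | comm {i k : Fin u} {j l : Fin v} (h1 : i < k) (h2 : l < j) :
      QMRel K q u v (FreeAlgebra.ι K (i, j) * FreeAlgebra.ι K (k, l))
        (FreeAlgebra.ι K (k, l) * FreeAlgebra.ι K (i, j))
  | quantum {i k : Fin u} {j l : Fin v} (h1 : i < k) (h2 : j < l) :
      QMRel K q u v (FreeAlgebra.ι K (i, j) * FreeAlgebra.ι K (k, l))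
        (FreeAlgebra.ι K (k, l) * FreeAlgebra.ι K (i, j) +
          (q - q⁻¹) • (FreeAlgebra.ι K (i, l) * FreeAlgebra.ι K (k, j)))

/-- The quantized coordinate ring `O_q(M_{u,v})` of `u × v` matrices. -/
abbrev OqM (K : Type) [Field K] (q : K) (u v : ℕ) :=
  RingQuot (QMRel K q u v)

/-- The canonical generators `X_{ij}` of `O_q(M_{u,v})`. -/
def Xg (K : Type) [Field K] (q : K) {u v : ℕ} (i : Fin u) (j : Fin v) : OqM K q u v :=
  RingQuot.mkAlgHom K (QMRel K q u v) (FreeAlgebra.ι K (i, j))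

/-- The number of inversions (the length) of a permutation of `Fin l`. -/
def invCount {l : ℕ} (σ : Equiv.Perm (Fin l)) : ℕ :=
  (Finset.univ.filter fun p : Fin l × Fin l => p.1 < p.2 ∧ σ p.2 < σ p.1).card

/-- The `l × l` quantum minor of `O_q(M_{u,v})` with rows `R 0, …, R (l-1)` and columns
`C 0, …, C (l-1)`:  `[R|C] = Σ_σ (-q)^{ℓ(σ)} X_{R 0, C (σ 0)} ⋯ X_{R (l-1), C (σ (l-1))}`. -/
def qMinor (K : Type) [Field K] (q : K) {u v l : ℕ} (R : Fin l → Fin u) (C : Fin l → Fin v) :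
    OqM K q u v :=
  ∑ σ : Equiv.Perm (Fin l),
    ((-q) ^ invCount σ) • (List.ofFn fun i : Fin l => Xg K q (R i) (C (σ i))).prod

/-- The relations killing all `(t+1) × (t+1)` quantum minors of `O_q(M_{m,n})`. -/
inductive DetRel (K : Type) [Field K] (q : K) (m n t : ℕ) :
    OqM K q m n → OqM K q m n → Prop
  | minor (R : Fin (t + 1) → Fin m) (C : Fin (t + 1) → Fin n)
      (hR : StrictMono R) (hC : StrictMono C) :
      DetRel K q m n t (qMinor K q R C) 0

/-- `O_q(M_{m,n}^{≤ t}) = O_q(M_{m,n}) / I_{t+1}`, the quotient by the ideal generated by all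
`(t+1) × (t+1)` quantum minors. -/
abbrev OqMle (K : Type) [Field K] (q : K) (m n t : ℕ) :=
  RingQuot (DetRel K q m n t)

/-- The quotient map `O_q(M_{m,n}) → O_q(M_{m,n}^{≤ t})`. -/
def mkle (K : Type) [Field K] (q : K) (m n t : ℕ) :
    OqM K q m n →ₐ[K] OqMle K q m n t :=
  RingQuot.mkAlgHom K (DetRel K q m n t)

/-- The two-sided ideal of a `K`-algebra `R` generated by a subset `S`, as a set. -/
def tsSpan (K : Type) [Field K] (R : Type) [Ring R] [Algebra K R] (S : Set R) : Set R :=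
  (Submodule.span K {x : R | ∃ a b : R, ∃ s ∈ S, x = a * s * b} : Submodule K R)

/-- The rows `{n-t+1, …, n}` (the lowest `t` rows). -/
def rowTop (n t : ℕ) (h : t ≤ n) : Fin t → Fin n :=
  fun i => ⟨n - t + i.1, by have := i.2; omega⟩

/-- The columns `{1, …, t}` (the leftmost `t` columns). -/
def colLeft (n t : ℕ) (h : t ≤ n) : Fin t → Fin n :=
  fun i => ⟨i.1, by have := i.2; omega⟩

/-- `d_Y = [n,…,n-t+1 | 1,…,t] ∈ O_q(M_{n,t})`. -/
def dY (K : Type) [Field K] (q : K) (n t : ℕ) (h : t ≤ n) : OqM K q n t :=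
  qMinor K q (rowTop n t h) (id : Fin t → Fin t)

/-- `d_Z = [t,…,1 | 1,…,t] ∈ O_q(M_{t,n})`. -/
def dZ (K : Type) [Field K] (q : K) (n t : ℕ) (h : t ≤ n) : OqM K q t n :=
  qMinor K q (id : Fin t → Fin t) (colLeft n t h)

/-- `d_X = [n,…,n-t+1 | 1,…,t] ∈ O_q(M_n)`. -/
def dX (K : Type) [Field K] (q : K) (n t : ℕ) (h : t ≤ n) : OqM K q n n :=
  qMinor K q (rowTop n t h) (colLeft n t h)

/-- `d_x = d_X + I_{t+1} ∈ O_q(M_n^{≤ t})`. -/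
def dx (K : Type) [Field K] (q : K) (n t : ℕ) (h : t ≤ n) : OqMle K q n n t :=
  mkle K q n n t (dX K q n t h)

/-- The quantum minor of `O_q(M_{u,v})` with row set `I` and column set `J` (interpreted as 0
when `|I| ≠ |J|`). -/
def qMinorF (K : Type) [Field K] (q : K) {u v : ℕ} (I : Finset (Fin u)) (J : Finset (Fin v)) :
    OqM K q u v :=
  if h : I.card = J.card then
    qMinor K q (fun i => ((I.orderIsoOfFin rfl i : I) : Fin u))
      (fun i => ((J.orderIsoOfFin h.symm i : J) : Fin v))
  else 0

/-- The row set `Ĩ = {n-t+1, …, n}`. -/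
def Itilde (n t : ℕ) (h : t ≤ n) : Finset (Fin n) := Finset.image (rowTop n t h) Finset.univ

/-- The column set `J̃ = {1, …, t}`. -/
def Jtilde (n t : ℕ) (h : t ≤ n) : Finset (Fin n) := Finset.image (colLeft n t h) Finset.univ

/-- Comparison of row-index sets: `I ≤ I'` iff `|I| ≥ |I'|` and, aligning the sorted lists at
their right ends, every entry of `I` dominates the corresponding entry of `I'`. -/
def rowLE {u : ℕ} (I I' : Finset (Fin u)) : Prop :=
  I'.card ≤ I.card ∧
    ∀ (s : ℕ) (x y : Fin u),
      (I.sort (· ≤ ·))[I.card - I'.card + s]? = some x →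
      (I'.sort (· ≤ ·))[s]? = some y → y ≤ x

/-- Comparison of column-index sets: `J ≤ J'` iff `|J| ≥ |J'|` and, aligning the sorted lists
at their left ends, every entry of `J` is dominated by the corresponding entry of `J'`. -/
def colLE {v : ℕ} (J J' : Finset (Fin v)) : Prop :=
  J'.card ≤ J.card ∧
    ∀ (s : ℕ) (x y : Fin v),
      (J.sort (· ≤ ·))[s]? = some x → (J'.sort (· ≤ ·))[s]? = some y → x ≤ y

/-- The order on index pairs labelling quantum minors. -/
def pairLE {u v : ℕ} (p p' : Finset (Fin u) × Finset (Fin v)) : Prop :=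
  rowLE p.1 p'.1 ∧ colLE p.2 p'.2

/-- A bitableau (a list of index pairs, i.e. of rows) is preferred if each row consists of a
nonempty row-index set and a column-index set of the same size, and the rows increase weakly
in the order on index pairs. -/
def IsPreferredBT {u v : ℕ} (L : List (Finset (Fin u) × Finset (Fin v))) : Prop :=
  (∀ p ∈ L, p.1.card = p.2.card ∧ 0 < p.1.card) ∧ L.Chain' pairLE

/-- The product of quantum minors `[T|T']` associated to a bitableau. -/
def btProd (K : Type) [Field K] (q : K) {u v : ℕ}
    (L : List (Finset (Fin u) × Finset (Fin v))) : OqM K q u v :=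
  (L.map fun p => qMinorF K q p.1 p.2).prod

/-- A family `x` of elements of an algebra is a quantum matrix if its entries satisfy the defining
relations of the quantized coordinate ring of matrices. -/
structure IsQMatrix {K B ι κ : Type*} [Field K] [Ring B] [Algebra K B] [LinearOrder ι]
    [LinearOrder κ] (q : K) (x : ι → κ → B) : Prop where
  row : ∀ ⦃i : ι⦄ ⦃j k : κ⦄, j < k → x i j * x i k = q • (x i k * x i j)
  col : ∀ ⦃i k : ι⦄ ⦃j : κ⦄, i < k → x i j * x k j = q • (x k j * x i j)
  comm : ∀ ⦃i k : ι⦄ ⦃j l : κ⦄, i < k → l < j → x i j * x k l = x k l * x i j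
  quantum : ∀ ⦃i k : ι⦄ ⦃j l : κ⦄, i < k → j < l →
    x i j * x k l = x k l * x i j + (q - q⁻¹) • (x i l * x k j)

theorem isQMatrix_Xg (K : Type) [Field K] (q : K) (u v : ℕ) :
    IsQMatrix q (Xg K q : Fin u → Fin v → OqM K q u v) where
  row i j k h := by
    simpa [Xg] using RingQuot.mkAlgHom_rel K (QMRel.row (K := K) (q := q) (i := i) h)
  col i k j h := by
    simpa [Xg] using RingQuot.mkAlgHom_rel K (QMRel.col (K := K) (q := q) (j := j) h)
  comm i k j l h h' := by
    simpa [Xg] using RingQuot.mkAlgHom_rel K (QMRel.comm (K := K) (q := q) h h')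
  quantum i k j l h h' := by
    simpa [Xg] using RingQuot.mkAlgHom_rel K (QMRel.quantum (K := K) (q := q) h h')

namespace IsQMatrix

variable {K B ι κ μ : Type*} [Field K] [Ring B] [Algebra K B] [LinearOrder ι] [LinearOrder κ]
  [LinearOrder μ] {q : K}

theorem transpose {x : ι → κ → B} (hx : IsQMatrix q x) : IsQMatrix q fun j i => x i j where
  row _ _ _ h := hx.col h
  col _ _ _ h := hx.row h
  comm _ _ _ _ h h' := (hx.comm h' h).symm
  quantum _ _ _ _ h h' := by rw [hx.quantum h' h, hx.comm h' h]

end IsQMatrix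

/-- The algebra map out of the quantized coordinate ring determined by a quantum matrix. -/
def OqM.lift {K B : Type} [Field K] {q : K} [Ring B] [Algebra K B] {u v : ℕ}
    (x : Fin u → Fin v → B) (hx : IsQMatrix q x) : OqM K q u v →ₐ[K] B :=
  RingQuot.liftAlgHom K ⟨FreeAlgebra.lift K fun p => x p.1 p.2, by
    rintro _ _ (h | h | ⟨h, h'⟩ | ⟨h, h'⟩)
    · simpa using hx.row h
    · simpa using hx.col h
    · simpa using hx.comm h h'
    · simpa using hx.quantum h h'⟩

theorem OqM.lift_Xg {K B : Type} [Field K] {q : K} [Ring B] [Algebra K B] {u v : ℕ}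
    (x : Fin u → Fin v → B) (hx : IsQMatrix q x) (i : Fin u) (j : Fin v) :
    OqM.lift x hx (Xg K q i j) = x i j := by
  simp [OqM.lift, Xg]

theorem OqM.induction {K : Type} [Field K] {q : K} {u v : ℕ} {p : OqM K q u v → Prop}
    (algebraMap : ∀ r, p (algebraMap K _ r)) (X : ∀ i j, p (Xg K q i j))
    (mul : ∀ a b, p a → p b → p (a * b)) (add : ∀ a b, p a → p b → p (a + b))
    (a : OqM K q u v) : p a := by
  obtain ⟨a, rfl⟩ := RingQuot.mkAlgHom_surjective K (QMRel K q u v) a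
  induction a using FreeAlgebra.induction with
  | grade0 r => simpa using algebraMap r
  | grade1 x => exact X x.1 x.2
  | mul a b ha hb => simpa using mul _ _ ha hb
  | add a b ha hb => simpa using add _ _ ha hb

section Sums

variable {M κ : Type*} [AddCommMonoid M] [LinearOrder κ]

theorem Finset.sum_sum_erase_comm (J : Finset κ) (F : κ → κ → M) :
    ∑ j ∈ J, ∑ k ∈ J.erase j, F j k = ∑ k ∈ J, ∑ j ∈ J.erase k, F j k := by
  refine Finset.sum_comm' fun x y => ?_
  simp only [Finset.mem_erase]
  tauto

theorem Finset.sum_sum_erase_eq_sum_lt (J : Finset κ) (F : κ → κ → M) :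
    ∑ j ∈ J, ∑ k ∈ J.erase j, F j k = ∑ j ∈ J, ∑ k ∈ J with j < k, (F j k + F k j) := by
  have h : ∀ j ∈ J, ∑ k ∈ J.erase j, F j k =
      ∑ k ∈ J with j < k, F j k + ∑ k ∈ J with k < j, F j k := by
    intro j _
    rw [← Finset.sum_union]
    · congr 1
      ext k
      simp only [Finset.mem_erase, Finset.mem_union, Finset.mem_filter]
      grind
    · rw [Finset.disjoint_left]
      grind
  rw [Finset.sum_congr rfl h, Finset.sum_add_distrib]
  simp only [Finset.sum_add_distrib]
  congr 1
  refine Finset.sum_comm' fun x y => ?_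
  simp only [Finset.mem_filter]
  tauto

end Sums

section Minors

variable {K B ι κ : Type*} [Field K] [Ring B] [Algebra K B] [LinearOrder κ] (q : K)

/-- The quantum minor of `x` with a list of rows and a finite set of columns, defined by expansion
along the first row. It vanishes if the sizes differ. -/
def listMinor (x : ι → κ → B) : List ι → Finset κ → B
  | [], J => if J = ∅ then 1 else 0
  | i :: is, J => ∑ j ∈ J, (-q) ^ (J.filter (· < j)).card • (x i j * listMinor x is (J.erase j))

/-- The quantum minor of `x` with given sets of rows and columns. -/
def setMinor [LinearOrder ι] (x : ι → κ → B) (I : Finset ι) (J : Finset κ) : B :=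
  listMinor q x (I.sort (· ≤ ·)) J

variable {q}

theorem listMinor_cons (x : ι → κ → B) (i : ι) (is : List ι) (J : Finset κ) :
    listMinor q x (i :: is) J =
      ∑ j ∈ J, (-q) ^ (J.filter (· < j)).card • (x i j * listMinor q x is (J.erase j)) := rfl

theorem listMinor_concat (x : ι → κ → B) (i : ι) (is : List ι) (J : Finset κ) :
    listMinor q x (is ++ [i]) J =
      ∑ j ∈ J, (-q) ^ (J.filter (j < ·)).card • (listMinor q x is (J.erase j) * x i j) := by
  induction is generalizing J with
  | nil =>
    simp only [List.nil_append, listMinor]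
    refine Finset.sum_congr rfl fun j hj => ?_
    by_cases h : J.erase j = ∅
    · have : J = {j} := by
        rw [← Finset.insert_erase hj, h]
        rfl
      subst this
      simp [Finset.filter_singleton]
    · simp [h]
  | cons l ls ih =>
    simp only [List.cons_append, listMinor_cons, ih, Finset.mul_sum, Finset.sum_mul,
      Finset.smul_sum]
    rw [Finset.sum_sum_erase_comm]
    refine Finset.sum_congr rfl fun k hk => Finset.sum_congr rfl fun j hj => ?_
    rw [Finset.erase_right_comm, mul_smul_comm, smul_mul_assoc, smul_smul, smul_smul, mul_assoc,
      ← pow_add, ← pow_add]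
    congr 2
    rw [Finset.mem_erase] at hj
    rw [Finset.filter_erase, Finset.filter_erase]
    rcases lt_or_gt_of_ne hj.1 with h | h
    · rw [Finset.erase_eq_of_notMem (by simp [h.le]), Finset.erase_eq_of_notMem (by simp [h.le])]
      ring
    · rw [Finset.card_erase_of_mem (by simp [h, hj.2]), Finset.card_erase_of_mem (by simp [h, hk])]
      have h1 : 0 < (J.filter (· < j)).card := Finset.card_pos.2 ⟨k, by simp [h, hk]⟩
      have h2 : 0 < (J.filter (k < ·)).card := Finset.card_pos.2 ⟨j, by simp [h, hj.2]⟩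
      omega

theorem listMinor_cons_cons (x : ι → κ → B) (a b : ι) (is : List ι) (J : Finset κ) :
    listMinor q x (a :: b :: is) J = ∑ j ∈ J, ∑ k ∈ J with j < k,
      (-q) ^ ((J.filter (· < j)).card + (J.filter (· < k)).card - 1) •
        ((x a j * x b k - q • (x a k * x b j)) * listMinor q x is ((J.erase j).erase k)) := by
  simp only [listMinor_cons, Finset.mul_sum, Finset.smul_sum]
  rw [Finset.sum_sum_erase_eq_sum_lt]
  refine Finset.sum_congr rfl fun j hj => Finset.sum_congr rfl fun k hk => ?_
  rw [Finset.mem_filter] at hk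
  rw [Finset.erase_right_comm (a := k)]
  have h0 : 0 < (J.filter (· < k)).card := Finset.card_pos.2 ⟨j, by simp [hk.2, hj]⟩
  have h1 : ((J.erase j).filter (· < k)).card = (J.filter (· < k)).card - 1 := by
    rw [Finset.filter_erase, Finset.card_erase_of_mem (by simp [hk.2, hj])]
  have h2 : ((J.erase k).filter (· < j)).card = (J.filter (· < j)).card := by
    rw [Finset.filter_erase, Finset.erase_eq_of_notMem (by simp [hk.2.le])]
  rw [h1, h2]
  simp only [mul_smul_comm, smul_smul, ← pow_add, sub_mul, smul_mul_assoc, smul_sub, mul_assoc]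
  obtain ⟨m, hm⟩ : ∃ m, (J.filter (· < k)).card = m + 1 := ⟨_, (Nat.succ_pred_eq_of_pos h0).symm⟩
  rw [hm, sub_eq_add_neg, ← neg_smul]
  congr 3
  rw [show (J.filter (· < j)).card + (m + 1) - 1 = m + (J.filter (· < j)).card by omega]
  ring

variable [LinearOrder ι] {x : ι → κ → B}

theorem IsQMatrix.listMinor_self (hx : IsQMatrix q x) (a : ι) (is : List ι) (J : Finset κ) :
    listMinor q x (a :: a :: is) J = 0 := by
  rw [listMinor_cons_cons]
  refine Finset.sum_eq_zero fun j _ => Finset.sum_eq_zero fun k hk => ?_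
  rw [hx.row (Finset.mem_filter.1 hk).2, sub_self, zero_mul, smul_zero]

theorem IsQMatrix.listMinor_swap (hx : IsQMatrix q x) (hq : q ≠ 0) {a b : ι} (h : a < b)
    (is : List ι) (J : Finset κ) :
    listMinor q x (b :: a :: is) J = -q • listMinor q x (a :: b :: is) J := by
  simp only [listMinor_cons_cons, Finset.smul_sum]
  refine Finset.sum_congr rfl fun j _ => Finset.sum_congr rfl fun k hk => ?_
  rw [smul_comm (-q)]
  congr 1
  rw [← smul_mul_assoc (-q)]
  congr 1
  rw [hx.quantum h (Finset.mem_filter.1 hk).2, ← hx.comm h (Finset.mem_filter.1 hk).2]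
  match_scalars <;> field_simp
  ring

theorem listMinor_sort_insert {I : Finset ι} {a : ι} (h : ∀ b ∈ I, a < b) :
    (insert a I).sort (· ≤ ·) = a :: I.sort (· ≤ ·) :=
  Finset.sort_insert _ (fun b hb => (h b hb).le) fun ha => (h a ha).false

theorem IsQMatrix.listMinor_cons_sort (hx : IsQMatrix q x) (hq : q ≠ 0) (m : ι) (I : Finset ι)
    (J : Finset κ) : listMinor q x (m :: I.sort (· ≤ ·)) J =
      if m ∈ I then 0 else (-q) ^ (I.filter (· < m)).card • setMinor q x (insert m I) J := by
  induction I using Finset.induction_on_min generalizing J with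
  | empty => simp [setMinor]
  | insert a s ha ih =>
    have has : a ∉ s := fun h => (ha a h).false
    rw [listMinor_sort_insert ha]
    rcases lt_trichotomy m a with h | rfl | h
    · have hlt : ∀ b ∈ insert a s, m < b := by
        intro b hb
        rcases Finset.mem_insert.1 hb with rfl | hb
        · exact h
        · exact h.trans (ha b hb)
      rw [if_neg fun hm => (hlt m hm).false, Finset.filter_false_of_mem fun b hb =>
        (hlt b hb).le.not_gt, setMinor, listMinor_sort_insert hlt, listMinor_sort_insert ha]
      simp
    · rw [hx.listMinor_self, if_pos (Finset.mem_insert_self _ _)]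
    · rw [hx.listMinor_swap hq h, listMinor_cons]
      simp only [ih]
      by_cases hm : m ∈ s
      · simp [hm]
      · have hlt : ∀ b ∈ insert m s, a < b := by
          intro b hb
          rcases Finset.mem_insert.1 hb with rfl | hb
          · exact h
          · exact ha b hb
        have hc : ((insert a s).filter (· < m)).card = (s.filter (· < m)).card + 1 := by
          rw [Finset.filter_insert, if_pos h, Finset.card_insert_of_notMem (by simp [has])]
        rw [if_neg (by simp [hm, h.ne']), Finset.insert_comm, setMinor,
          listMinor_sort_insert hlt, listMinor_cons, hc, pow_succ', mul_smul]
        congr 1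
        rw [Finset.smul_sum]
        refine Finset.sum_congr rfl fun j _ => ?_
        rw [if_neg hm, mul_smul_comm, smul_comm, setMinor]

theorem IsQMatrix.listMinor_sort_concat (hx : IsQMatrix q x) (hq : q ≠ 0) (m : ι) (I : Finset ι)
    (J : Finset κ) : listMinor q x (I.sort (· ≤ ·) ++ [m]) J =
      if m ∈ I then 0 else (-q) ^ (I.filter (m < ·)).card • setMinor q x (insert m I) J := by
  induction I using Finset.induction_on_min generalizing J with
  | empty => simp [setMinor]
  | insert a s ha ih =>
    have has : a ∉ s := fun h => (ha a h).false
    rw [listMinor_sort_insert ha, List.cons_append, listMinor_cons]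
    simp only [ih]
    by_cases hm : m ∈ s
    · simp [hm]
    · simp only [hm, if_false, Finset.mem_insert, or_false, mul_smul_comm]
      have h0 : ∑ j ∈ J, (-q) ^ (J.filter (· < j)).card • (-q) ^ (s.filter (m < ·)).card •
          (x a j * setMinor q x (insert m s) (J.erase j)) =
          (-q) ^ (s.filter (m < ·)).card • listMinor q x (a :: (insert m s).sort (· ≤ ·)) J := by
        rw [listMinor_cons, Finset.smul_sum]
        exact Finset.sum_congr rfl fun j _ => smul_comm _ _ _
      rw [h0]
      simp only [setMinor]
      rcases lt_trichotomy m a with h | rfl | h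
      · have hms : ∀ b ∈ s, m < b := fun b hb => h.trans (ha b hb)
        have hlt : ∀ b ∈ insert a s, m < b := by
          intro b hb
          rcases Finset.mem_insert.1 hb with rfl | hb
          · exact h
          · exact hms b hb
        rw [listMinor_sort_insert hms, hx.listMinor_swap hq h, if_neg h.ne,
          listMinor_sort_insert hlt, listMinor_sort_insert ha, Finset.filter_insert, if_pos h,
          Finset.card_insert_of_notMem (by simp [has]), smul_smul, pow_succ]
      · rw [listMinor_sort_insert ha, hx.listMinor_self, if_pos rfl, smul_zero]
      · have hlt : ∀ b ∈ insert m s, a < b := by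
          intro b hb
          rcases Finset.mem_insert.1 hb with rfl | hb
          · exact h
          · exact ha b hb
        rw [if_neg h.ne', Finset.insert_comm, listMinor_sort_insert hlt, Finset.filter_insert,
          if_neg h.le.not_gt]

end Minors

theorem Commute.listMinor {K B ι κ : Type*} [Field K] [Ring B] [Algebra K B] [LinearOrder κ]
    {q : K} {T : B} {x : ι → κ → B} {is : List ι} {J : Finset κ}
    (h : ∀ i ∈ is, ∀ j ∈ J, Commute T (x i j)) : Commute T (listMinor q x is J) := by
  induction is generalizing J with
  | nil =>
    simp only [_root_.listMinor]
    split_ifs <;> simp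
  | cons i is ih =>
    rw [listMinor_cons]
    refine Commute.sum_right _ _ _ fun j hj => ((h i (by simp) j hj).mul_right ?_).smul_right _
    exact ih fun i' hi' j' hj' => h i' (by simp [hi']) j' (Finset.mem_of_mem_erase hj')

theorem Finset.sum_sum_notMem_eq_sum_sum_mem {α M : Type*} [Fintype α] [DecidableEq α]
    [AddCommMonoid M] (F : α → Finset α → Finset α → M) :
    ∑ L : Finset α, ∑ m, (if m ∈ L then 0 else F m L (insert m L)) =
      ∑ L : Finset α, ∑ m ∈ L, F m (L.erase m) L := by
  have h : ∀ L : Finset α, ∑ m, (if m ∈ L then 0 else F m L (insert m L)) =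
      ∑ m ∈ Lᶜ, F m L (insert m L) := by
    intro L
    rw [← Finset.sum_subset (Finset.subset_univ Lᶜ)]
    · exact Finset.sum_congr rfl fun m hm => if_neg (Finset.mem_compl.1 hm)
    · intro m _ hm
      rw [if_pos (by simpa using hm)]
  simp only [h, Finset.sum_sigma']
  refine Finset.sum_bij' (fun p _ => ⟨insert p.2 p.1, p.2⟩) (fun p _ => ⟨p.1.erase p.2, p.2⟩)
    ?_ ?_ ?_ ?_ ?_
  · simp
  · simp
  · rintro ⟨L, m⟩ hp
    have : m ∉ L := by simpa using hp
    simp [Finset.erase_insert this]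
  · rintro ⟨L, m⟩ hp
    have : m ∈ L := by simpa using hp
    simp [Finset.insert_erase this]
  · rintro ⟨L, m⟩ hp
    have : m ∉ L := by simpa using hp
    simp [Finset.erase_insert this]

section MinorTheory

variable {K B ι κ μ : Type*} [Field K] [Ring B] [Algebra K B] [LinearOrder κ] [LinearOrder μ]
  {q : K}

theorem setMinor_empty [LinearOrder ι] (x : ι → κ → B) (J : Finset κ) :
    setMinor q x ∅ J = if J = ∅ then 1 else 0 := by
  simp [setMinor, listMinor]

/-- The Cauchy–Binet formula for a product of quantum matrices with commuting entries. -/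
theorem IsQMatrix.listMinor_mul [Fintype μ] (hq : q ≠ 0) {x : ι → μ → B} {z : μ → κ → B}
    (hz : IsQMatrix q z) (hc : ∀ i m m' j, Commute (x i m) (z m' j)) (is : List ι)
    (J : Finset κ) : listMinor q (fun i j => ∑ m, x i m * z m j) is J =
      ∑ L : Finset μ, listMinor q x is L * setMinor q z L J := by
  induction is generalizing J with
  | nil => simp [listMinor, setMinor_empty]
  | cons i is ih =>
    have h1 : ∀ m L, ∑ j ∈ J, (-q) ^ (J.filter (· < j)).card •
        (x i m * z m j * (listMinor q x is L * setMinor q z L (J.erase j))) =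
        if m ∈ L then 0 else (-q) ^ (L.filter (· < m)).card •
          (x i m * listMinor q x is L * setMinor q z (insert m L) J) := by
      intro m L
      have : ∑ j ∈ J, (-q) ^ (J.filter (· < j)).card •
          (x i m * z m j * (listMinor q x is L * setMinor q z L (J.erase j))) =
          x i m * listMinor q x is L * listMinor q z (m :: L.sort (· ≤ ·)) J := by
        rw [listMinor_cons, Finset.mul_sum]
        refine Finset.sum_congr rfl fun j _ => ?_
        have hcm : Commute (z m j) (listMinor q x is L) :=
          Commute.listMinor fun i' _ m' _ => (hc i' m' m j).symm
        rw [mul_smul_comm, mul_assoc, ← mul_assoc (z m j), hcm.eq]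
        simp only [mul_assoc, setMinor]
      rw [this, hz.listMinor_cons_sort hq]
      split_ifs
      · simp
      · rw [mul_smul_comm]
    rw [listMinor_cons]
    simp only [ih, Finset.sum_mul_sum, Finset.smul_sum]
    rw [Finset.sum_comm]
    simp only [Finset.sum_comm (s := J)]
    simp only [h1, listMinor_cons, Finset.sum_mul, smul_mul_assoc]
    rw [Finset.sum_comm]
    rw [Finset.sum_sum_notMem_eq_sum_sum_mem fun m L L' => (-q) ^ (L.filter (· < m)).card •
      (x i m * listMinor q x is L * setMinor q z L' J)]
    refine Finset.sum_congr rfl fun L _ => Finset.sum_congr rfl fun m _ => ?_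
    rw [Finset.filter_erase, Finset.erase_eq_of_notMem (by simp)]

variable [LinearOrder ι]

theorem setMinor_insert_left (x : ι → κ → B) {i : ι} {I : Finset ι} (hi : ∀ b ∈ I, i < b)
    (J : Finset κ) : setMinor q x (insert i I) J =
      ∑ l ∈ J, (-q) ^ (J.filter (· < l)).card • (x i l * setMinor q x I (J.erase l)) := by
  rw [setMinor, listMinor_sort_insert hi]
  rfl

theorem setMinor_insert_insert (x : ι → κ → B) {i : ι} {I : Finset ι} (hi : ∀ b ∈ I, i < b)
    {j : κ} {J : Finset κ} (hj : ∀ b ∈ J, j < b) : setMinor q x (insert i I) (insert j J) =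
      x i j * setMinor q x I J + ∑ l ∈ J, (-q) ^ ((J.filter (· < l)).card + 1) •
        (x i l * setMinor q x I (insert j (J.erase l))) := by
  have hjJ : j ∉ J := fun h => (hj j h).false
  rw [setMinor_insert_left x hi, Finset.sum_insert hjJ, Finset.erase_insert hjJ]
  congr 1
  · rw [Finset.filter_false_of_mem]
    · simp
    · intro b hb
      rcases Finset.mem_insert.1 hb with rfl | hb
      · simp
      · exact (hj b hb).le.not_gt
  · refine Finset.sum_congr rfl fun l hl => ?_
    rw [Finset.filter_insert, if_pos (hj l hl), Finset.card_insert_of_notMem (by simp [hjJ]),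
      Finset.erase_insert_of_ne (hj l hl).ne]

theorem Finset.exists_eq_insert_min {α : Type*} [LinearOrder α] {s : Finset α} (hs : s.Nonempty) :
    ∃ a t, s = insert a t ∧ (∀ b ∈ t, a < b) ∧ t.card < s.card := by
  refine ⟨s.min' hs, s.erase (s.min' hs), (Finset.insert_erase (s.min'_mem hs)).symm,
    fun b hb => s.min'_lt_of_mem_erase_min' hs hb, Finset.card_erase_lt_of_mem (s.min'_mem hs)⟩

/-- Quantum minors are invariant under transposition. -/
theorem IsQMatrix.setMinor_transpose {x : ι → κ → B} (hx : IsQMatrix q x) (I : Finset ι)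
    (J : Finset κ) : setMinor q (fun j i => x i j) J I = setMinor q x I J := by
  induction hn : I.card using Nat.strong_induction_on generalizing I J with
  | _ n ih =>
    rcases I.eq_empty_or_nonempty with rfl | hI
    · rcases J.eq_empty_or_nonempty with rfl | hJ
      · simp [setMinor_empty]
      · obtain ⟨j, J, rfl, hj, -⟩ := Finset.exists_eq_insert_min hJ
        rw [setMinor_insert_left _ hj]
        simp [setMinor_empty]
    · obtain ⟨i, I, rfl, hi, hc⟩ := Finset.exists_eq_insert_min hI
      rcases J.eq_empty_or_nonempty with rfl | hJ
      · rw [setMinor_insert_left _ hi]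
        simp [setMinor_empty]
      · obtain ⟨j, J, rfl, hj, -⟩ := Finset.exists_eq_insert_min hJ
        have hcard : (insert i I).card = I.card + 1 :=
          Finset.card_insert_of_notMem fun h => (hi i h).false
        have hL : ∀ l ∈ J, setMinor q x I (insert j (J.erase l)) =
            ∑ k ∈ I, (-q) ^ (I.filter (· < k)).card •
              (x k j * setMinor q x (I.erase k) (J.erase l)) := by
          intro l hl
          rw [← ih _ (hn ▸ hc) _ _ rfl,
            setMinor_insert_left _ fun b hb => hj b (Finset.mem_of_mem_erase hb)]
          refine Finset.sum_congr rfl fun k hk => ?_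
          rw [ih _ (hn ▸ (Finset.card_erase_lt_of_mem hk).trans hc) _ _ rfl]
        have hR : ∀ k ∈ I, setMinor q (fun j i => x i j) J (insert i (I.erase k)) =
            ∑ l ∈ J, (-q) ^ (J.filter (· < l)).card •
              (x i l * setMinor q x (I.erase k) (J.erase l)) := by
          intro k hk
          have : (insert i (I.erase k)).card < n := by
            rw [← hn, hcard]
            refine (Finset.card_insert_le _ _).trans_lt ?_
            have := Finset.card_erase_lt_of_mem hk
            omega
          rw [ih _ this _ _ rfl,
            setMinor_insert_left _ fun b hb => hi b (Finset.mem_of_mem_erase hb)]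
        rw [setMinor_insert_insert _ hi hj, setMinor_insert_insert _ hj hi,
          ih _ (hn ▸ hc) _ _ rfl]
        congr 1
        refine (Finset.sum_congr rfl fun k hk => by rw [hR k hk]).trans ?_
        refine Eq.trans ?_ (Finset.sum_congr rfl fun l hl => by rw [hL l hl]).symm
        simp only [Finset.mul_sum, Finset.smul_sum]
        rw [Finset.sum_comm]
        refine Finset.sum_congr rfl fun l hl => Finset.sum_congr rfl fun k hk => ?_
        simp only [mul_smul_comm, smul_smul, ← mul_assoc]
        rw [hx.comm (hi k hk) (hj l hl)]
        congr 1
        ring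

end MinorTheory

section QMatrixMul

theorem Finset.sum_sum_eq_sum_diag_add_sum_lt {M α : Type*} [AddCommMonoid M] [Fintype α]
    [LinearOrder α] (F : α → α → M) : ∑ m, ∑ n, F m n =
      ∑ m, F m m + ∑ m, ∑ n with m < n, (F m n + F n m) := by
  rw [← Finset.sum_sum_erase_eq_sum_lt, ← Finset.sum_add_distrib]
  exact Finset.sum_congr rfl fun m _ => (Finset.add_sum_erase _ _ (Finset.mem_univ m)).symm

theorem sum_mul_mul_sum_mul_eq {B ι κ μ : Type*} [Ring B] [LinearOrder μ] [Fintype μ]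
    {x : ι → μ → B} {z : μ → κ → B}
    (hc : ∀ i m m' j, Commute (x i m) (z m' j)) (i k : ι) (j l : κ) :
    (∑ m, x i m * z m j) * ∑ m, x k m * z m l =
      ∑ m, x i m * x k m * (z m j * z m l) + ∑ m, ∑ n with m < n,
        (x i m * x k n * (z m j * z n l) + x i n * x k m * (z n j * z m l)) := by
  rw [Finset.sum_mul_sum, ← Finset.sum_sum_eq_sum_diag_add_sum_lt
    fun m n => x i m * x k n * (z m j * z n l)]
  refine Finset.sum_congr rfl fun m _ => Finset.sum_congr rfl fun n _ => ?_
  rw [mul_assoc, ← mul_assoc (z m j), ← (hc k n m j).eq]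
  simp only [mul_assoc]

variable {K B ι κ μ : Type*} [Field K] [Ring B] [Algebra K B] [LinearOrder ι] [LinearOrder κ]
  [LinearOrder μ] {q : K}

theorem IsQMatrix.row_mul [Fintype μ] (hq : q ≠ 0) {x : ι → μ → B} {z : μ → κ → B}
    (hx : IsQMatrix q x) (hz : IsQMatrix q z) (hc : ∀ i m m' j, Commute (x i m) (z m' j))
    ⦃i : ι⦄ ⦃j k : κ⦄ (h : j < k) :
    (∑ m, x i m * z m j) * ∑ m, x i m * z m k =
      q • ((∑ m, x i m * z m k) * ∑ m, x i m * z m j) := by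
  simp only [sum_mul_mul_sum_mul_eq hc, smul_add, Finset.smul_sum]
  congr 1
  · refine Finset.sum_congr rfl fun m _ => ?_
    rw [hz.row h, mul_smul_comm]
  · refine Finset.sum_congr rfl fun m _ => Finset.sum_congr rfl fun n hn => ?_
    have hmn := (Finset.mem_filter.1 hn).2
    rw [hx.row hmn, hz.quantum hmn h, hz.comm hmn h]
    simp only [mul_add, smul_mul_assoc, mul_smul_comm]
    match_scalars <;> field_simp
    ring

theorem IsQMatrix.mul [Fintype μ] (hq : q ≠ 0) {x : ι → μ → B} {z : μ → κ → B}
    (hx : IsQMatrix q x) (hz : IsQMatrix q z) (hc : ∀ i m m' j, Commute (x i m) (z m' j)) :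
    IsQMatrix q fun i j => ∑ m, x i m * z m j where
  row i j k h := hx.row_mul hq hz hc h
  col i k j h := by
    have := hz.transpose.row_mul hq hx.transpose (fun j m m' i => (hc i m' m j).symm) (i := j) h
    simpa only [(hc _ _ _ _).symm.eq] using this
  comm i k j l h h' := by
    simp only [sum_mul_mul_sum_mul_eq hc]
    congr 1
    · refine Finset.sum_congr rfl fun m _ => ?_
      rw [hx.col h, hz.row h', smul_mul_assoc, mul_smul_comm]
    · refine Finset.sum_congr rfl fun m _ => Finset.sum_congr rfl fun n hn => ?_
      have hmn := (Finset.mem_filter.1 hn).2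
      rw [hx.quantum h hmn, hz.quantum hmn h', hx.comm h hmn, hz.comm hmn h']
      simp only [mul_add, add_mul, smul_mul_assoc, mul_smul_comm]
      match_scalars <;> ring
  quantum i k j l h h' := by
    simp only [sum_mul_mul_sum_mul_eq hc, smul_add, Finset.smul_sum]
    rw [add_add_add_comm]
    congr 1
    · rw [← Finset.sum_add_distrib]
      refine Finset.sum_congr rfl fun m _ => ?_
      rw [hx.col h, hz.row h']
      simp only [smul_mul_assoc, mul_smul_comm]
      match_scalars
      field_simp
      ring
    · simp only [← Finset.sum_add_distrib]
      refine Finset.sum_congr rfl fun m _ => Finset.sum_congr rfl fun n hn => ?_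
      have hmn := (Finset.mem_filter.1 hn).2
      rw [hx.quantum h hmn, hz.quantum hmn h', hx.comm h hmn, hz.comm hmn h']
      simp only [mul_add, add_mul, smul_mul_assoc, mul_smul_comm]
      match_scalars <;> ring

end QMatrixMul

section Normal

variable {K B ι κ : Type*} [Field K] [Ring B] [Algebra K B] [LinearOrder ι] [LinearOrder κ]
  {q : K} {x : ι → κ → B} {I : Finset ι} {J : Finset κ}

theorem Finset.card_filter_lt_add_card_filter_gt {α : Type*} [LinearOrder α] {s : Finset α} {a : α}
    (h : a ∈ s) : (s.filter (· < a)).card + (s.filter (a < ·)).card + 1 = s.card := by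
  rw [← Finset.card_erase_add_one h, ← Finset.card_union_of_disjoint]
  · congr 2
    ext b
    simp only [Finset.mem_union, Finset.mem_filter, Finset.mem_erase]
    grind
  · rw [Finset.disjoint_left]
    grind

theorem IsQMatrix.smul_mul_setMinor (hx : IsQMatrix q x) (hq : q ≠ 0) (p : ι) {j : κ}
    (hj : j ∈ J) : (-q) ^ (J.card - 1) • (x p j * setMinor q x I J) =
      ∑ k ∈ I, (-q) ^ (I.filter (k < ·)).card •
        (listMinor q x (p :: (I.erase k).sort (· ≤ ·)) J * x k j) := by
  have h : ∀ l ∈ J, ∑ k ∈ I, (-q) ^ (I.filter (k < ·)).card •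
      (x p l * setMinor q x (I.erase k) (J.erase l) * x k j) =
      if l = j then (-q) ^ (J.filter (j < ·)).card • (x p j * setMinor q x I J) else 0 := by
    intro l hl
    have := hx.transpose.listMinor_sort_concat hq j (J.erase l) I
    rw [listMinor_concat] at this
    calc _ = x p l * ∑ k ∈ I, (-q) ^ (I.filter (k < ·)).card •
          (setMinor q (fun j i => x i j) (J.erase l) (I.erase k) * x k j) := by
          rw [Finset.mul_sum]
          refine Finset.sum_congr rfl fun k _ => ?_
          rw [hx.setMinor_transpose, mul_smul_comm, mul_assoc]
      _ = _ := by
          simp only [setMinor] at this ⊢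
          rw [this]
          split_ifs with h1 h2 h2
          · exact absurd h2.symm (Finset.ne_of_mem_erase h1)
          · rw [mul_zero]
          · subst h2
            rw [Finset.insert_erase hl, Finset.filter_erase,
              Finset.erase_eq_of_notMem (by simp), mul_smul_comm]
            congr 2
            exact hx.setMinor_transpose I J
          · exact absurd (Finset.mem_erase.2 ⟨Ne.symm h2, hj⟩) h1
  calc _ = ∑ l ∈ J, (-q) ^ (J.filter (· < l)).card • ∑ k ∈ I, (-q) ^ (I.filter (k < ·)).card •
          (x p l * setMinor q x (I.erase k) (J.erase l) * x k j) := by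
        rw [Finset.sum_congr rfl fun l hl => by rw [h l hl]]
        simp only [smul_ite, smul_zero, Finset.sum_ite_eq', hj, if_true]
        rw [smul_smul, ← pow_add]
        congr 2
        have := Finset.card_filter_lt_add_card_filter_gt hj
        omega
    _ = _ := by
        simp only [listMinor_cons, Finset.smul_sum, Finset.sum_mul]
        rw [Finset.sum_comm]
        refine Finset.sum_congr rfl fun k _ => Finset.sum_congr rfl fun l _ => ?_
        rw [smul_comm, smul_mul_assoc]
        rfl

theorem IsQMatrix.sum_insert_erase (hx : IsQMatrix q x) (hq : q ≠ 0) {p : ι} (hp : p ∉ I) {j : κ}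
    (hj : j ∈ J) : (-q) ^ (I.filter (p < ·)).card • (setMinor q x I J * x p j) +
      ∑ k ∈ I, (-q) ^ ((insert p I).filter (k < ·)).card •
        (setMinor q x (insert p (I.erase k)) J * x k j) = 0 := by
  have := hx.transpose.listMinor_sort_concat hq j J (insert p I)
  rw [if_pos hj, listMinor_concat, Finset.sum_insert hp, Finset.erase_insert hp,
    Finset.filter_insert, if_neg (lt_irrefl p)] at this
  rw [← this]
  congr 1
  · rw [← hx.setMinor_transpose]
    rfl
  · refine Finset.sum_congr rfl fun k hk => ?_
    rw [← hx.setMinor_transpose, Finset.erase_insert_of_ne (by rintro rfl; exact hp hk)]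
    rfl

theorem IsQMatrix.commute_setMinor (hx : IsQMatrix q x) (hq : q ≠ 0) (hIJ : I.card = J.card)
    {p : ι} (hp : p ∈ I) {j : κ} (hj : j ∈ J) : x p j * setMinor q x I J =
      setMinor q x I J * x p j := by
  have h := hx.smul_mul_setMinor (I := I) hq p hj
  rw [Finset.sum_eq_single_of_mem p hp] at h
  · rw [hx.listMinor_cons_sort hq, if_neg (by simp), Finset.insert_erase hp, Finset.filter_erase,
      Finset.erase_eq_of_notMem (by simp), smul_mul_assoc, smul_smul, ← pow_add] at h
    have := Finset.card_filter_lt_add_card_filter_gt hp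
    rw [show (I.filter (p < ·)).card + (I.filter (· < p)).card = J.card - 1 by omega] at h
    exact smul_right_injective B (pow_ne_zero _ (neg_ne_zero.2 hq)) h
  · intro k _ hk
    rw [hx.listMinor_cons_sort hq, if_pos (by simp [hp, hk.symm]), zero_mul, smul_zero]

theorem IsQMatrix.mul_setMinor_of_lt (hx : IsQMatrix q x) (hq : q ≠ 0) (hIJ : I.card = J.card)
    {p : ι} (hp : ∀ k ∈ I, p < k) {j : κ} (hj : j ∈ J) : x p j * setMinor q x I J =
      q • (setMinor q x I J * x p j) := by
  have hpI : p ∉ I := fun h => (hp p h).false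
  have h := hx.smul_mul_setMinor (I := I) hq p hj
  have h0 := hx.sum_insert_erase hq hpI hj
  rw [Finset.filter_true_of_mem hp] at h0
  have h1 : ∑ k ∈ I, (-q) ^ (I.filter (k < ·)).card •
      (listMinor q x (p :: (I.erase k).sort (· ≤ ·)) J * x k j) =
      ∑ k ∈ I, (-q) ^ ((insert p I).filter (k < ·)).card •
        (setMinor q x (insert p (I.erase k)) J * x k j) := by
    refine Finset.sum_congr rfl fun k hk => ?_
    rw [hx.listMinor_cons_sort hq, if_neg (by simp [hpI]), Finset.filter_insert,
      if_neg (hp k hk).le.not_gt, Finset.filter_false_of_mem (s := I.erase k)]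
    · simp
    · exact fun b hb => (hp b (Finset.mem_of_mem_erase hb)).le.not_gt
  rw [h1, ← neg_eq_of_add_eq_zero_right h0] at h
  refine smul_right_injective B (pow_ne_zero (J.card - 1) (neg_ne_zero.2 hq)) ?_
  simp only [h]
  obtain ⟨m, hm⟩ : ∃ m, J.card = m + 1 :=
    ⟨_, (Nat.succ_pred_eq_of_pos (Finset.card_pos.2 ⟨j, hj⟩)).symm⟩
  rw [hIJ, hm, smul_smul, ← neg_smul]
  congr 1
  simp [pow_succ]

theorem IsQMatrix.mul_setMinor_of_gt (hx : IsQMatrix q x) (hq : q ≠ 0) (hIJ : I.card = J.card)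
    {p : ι} (hp : ∀ k ∈ I, k < p) {j : κ} (hj : j ∈ J) : x p j * setMinor q x I J =
      q⁻¹ • (setMinor q x I J * x p j) := by
  have hpI : p ∉ I := fun h => (hp p h).false
  have h := hx.smul_mul_setMinor (I := I) hq p hj
  have h0 := hx.sum_insert_erase hq hpI hj
  rw [Finset.filter_false_of_mem fun k hk => (hp k hk).le.not_gt, Finset.card_empty, pow_zero,
    one_smul] at h0
  have h1 : (-q) • ∑ k ∈ I, (-q) ^ (I.filter (k < ·)).card •
      (listMinor q x (p :: (I.erase k).sort (· ≤ ·)) J * x k j) =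
      (-q) ^ (J.card - 1) • ∑ k ∈ I, (-q) ^ ((insert p I).filter (k < ·)).card •
        (setMinor q x (insert p (I.erase k)) J * x k j) := by
    rw [Finset.smul_sum, Finset.smul_sum]
    refine Finset.sum_congr rfl fun k hk => ?_
    rw [hx.listMinor_cons_sort hq, if_neg (by simp [hpI]), Finset.filter_insert,
      if_pos (hp k hk), Finset.card_insert_of_notMem (by simp [hpI]),
      Finset.filter_true_of_mem (s := I.erase k), Finset.card_erase_of_mem hk, hIJ]
    · simp only [smul_mul_assoc, smul_smul]
      congr 1
      ring
    · exact fun b hb => hp b (Finset.mem_of_mem_erase hb)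
  rw [← h, ← neg_eq_of_add_eq_zero_right h0, smul_comm] at h1
  have h2 := smul_right_injective B (pow_ne_zero (J.card - 1) (neg_ne_zero.2 hq)) h1
  rw [neg_smul, neg_inj] at h2
  rw [← h2, inv_smul_smul₀ hq]

/-- A minor on final rows and initial columns commutes up to scalars with the generators. -/
theorem IsQMatrix.exists_mul_setMinor_eq_smul (hx : IsQMatrix q x) (hq : q ≠ 0)
    (hIJ : I.card = J.card) (hI : ∀ i ∉ I, ∀ k ∈ I, i < k) (hJ : ∀ l ∉ J, ∀ j ∈ J, j < l)
    (i : ι) (j : κ) : ∃ c : K, c ≠ 0 ∧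
      x i j * setMinor q x I J = c • (setMinor q x I J * x i j) := by
  by_cases hi : i ∈ I
  · by_cases hj : j ∈ J
    · exact ⟨1, one_ne_zero, by rw [one_smul, hx.commute_setMinor hq hIJ hi hj]⟩
    · refine ⟨q⁻¹, inv_ne_zero hq, ?_⟩
      rw [← hx.setMinor_transpose]
      exact hx.transpose.mul_setMinor_of_gt hq hIJ.symm (hJ j hj) hi
  · by_cases hj : j ∈ J
    · exact ⟨q, hq, hx.mul_setMinor_of_lt hq hIJ (hI i hi) hj⟩
    · refine ⟨1, one_ne_zero, ?_⟩
      rw [one_smul]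
      exact Commute.listMinor fun k hk l hl =>
        hx.comm (hI i hi k ((Finset.mem_sort _).1 hk)) (hJ j hj l hl)

end Normal

section PermutationExpansion

theorem invCount_eq_sum {l : ℕ} (σ : Equiv.Perm (Fin l)) :
    invCount σ = ∑ a, ∑ b, if a < b ∧ σ b < σ a then 1 else 0 := by
  rw [invCount, Finset.card_filter, Fintype.sum_prod_type]

/-- The permutation sending `0` to `p` and restricting to `τ` on the complements. -/
def Fin.insertPerm {l : ℕ} (p : Fin (l + 1)) (τ : Equiv.Perm (Fin l)) :
    Equiv.Perm (Fin (l + 1)) :=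
  p.cycleRange.symm * Equiv.Perm.decomposeFin.symm (0, τ)

@[simp] theorem Fin.insertPerm_zero {l : ℕ} (p : Fin (l + 1)) (τ : Equiv.Perm (Fin l)) :
    Fin.insertPerm p τ 0 = p := by
  simp [Fin.insertPerm]

@[simp] theorem Fin.insertPerm_succ {l : ℕ} (p : Fin (l + 1)) (τ : Equiv.Perm (Fin l))
    (i : Fin l) : Fin.insertPerm p τ i.succ = p.succAbove (τ i) := by
  simp [Fin.insertPerm]

theorem Fin.insertPerm_bijective (l : ℕ) : Function.Bijective
    fun p : Fin (l + 1) × Equiv.Perm (Fin l) => Fin.insertPerm p.1 p.2 := by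
  rw [Fintype.bijective_iff_injective_and_card]
  constructor
  · rintro ⟨p, τ⟩ ⟨p', τ'⟩ h
    have h0 : p = p' := by simpa using DFunLike.congr_fun h 0
    subst h0
    congr 1
    ext i : 1
    simpa using DFunLike.congr_fun h i.succ
  · simp [Fintype.card_perm, Nat.factorial_succ]

theorem Fin.card_filter_succAbove_lt {l : ℕ} (p : Fin (l + 1)) :
    (Finset.univ.filter fun i : Fin l => p.succAbove i < p).card = p := by
  simp only [Fin.succAbove_lt_iff_castSucc_lt]
  simp only [Fin.lt_def, Fin.val_castSucc]
  rw [Fin.card_filter_val_lt]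
  omega

theorem invCount_insertPerm {l : ℕ} (p : Fin (l + 1)) (τ : Equiv.Perm (Fin l)) :
    invCount (Fin.insertPerm p τ) = p + invCount τ := by
  rw [invCount_eq_sum, Fin.sum_univ_succ]
  simp only [Fin.sum_univ_succ, Fin.insertPerm_zero, Fin.insertPerm_succ, lt_self_iff_false,
    false_and, if_false, zero_add, Fin.succ_pos, true_and, Fin.not_lt_zero, Fin.succ_lt_succ_iff,
    Fin.succAbove_lt_succAbove_iff]
  rw [invCount_eq_sum, ← Finset.card_filter]
  congr 1
  conv_rhs => rw [← Fin.card_filter_succAbove_lt p]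
  exact Finset.card_equiv τ (by simp)

theorem qMinor_succ (K : Type) [Field K] (q : K) {u v l : ℕ} (R : Fin (l + 1) → Fin u)
    (C : Fin (l + 1) → Fin v) : qMinor K q R C = ∑ p : Fin (l + 1), (-q) ^ (p : ℕ) •
      (Xg K q (R 0) (C p) * qMinor K q (fun i => R i.succ) fun i => C (p.succAbove i)) := by
  simp only [qMinor]
  rw [← (Fin.insertPerm_bijective l).sum_comp, Fintype.sum_prod_type]
  simp only [Finset.mul_sum, Finset.smul_sum]
  refine Finset.sum_congr rfl fun p _ => Finset.sum_congr rfl fun τ _ => ?_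
  rw [invCount_insertPerm, mul_smul_comm, smul_smul, ← pow_add, List.ofFn_succ, List.prod_cons]
  simp

theorem qMinor_eq_listMinor (K : Type) [Field K] (q : K) {u v l : ℕ} (R : Fin l → Fin u)
    (C : Fin l → Fin v) (hC : StrictMono C) :
    qMinor K q R C = listMinor q (Xg K q) (List.ofFn R) (Finset.univ.image C) := by
  induction l with
  | zero =>
    simp [qMinor, listMinor, invCount]
  | succ l ih =>
    rw [qMinor_succ, List.ofFn_succ, listMinor_cons, Finset.sum_image hC.injective.injOn]
    refine Finset.sum_congr rfl fun p _ => ?_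
    rw [ih _ (fun i => C (p.succAbove i)) fun a b h => hC (Fin.strictMono_succAbove p h)]
    congr 2
    · rw [Finset.filter_image, Finset.card_image_of_injective _ hC.injective]
      simp only [hC.lt_iff_lt, Fin.lt_def]
      rw [Fin.card_filter_val_lt]
      omega
    · congr 2
      ext j
      simp only [Finset.mem_image, Finset.mem_univ, true_and, Finset.mem_erase]
      constructor
      · rintro ⟨i, rfl⟩
        exact ⟨fun h => Fin.succAbove_ne p i (hC.injective h), p.succAbove i, rfl⟩
      · rintro ⟨hj, a, rfl⟩
        obtain ⟨i, rfl⟩ := Fin.exists_succAbove_eq (x := a) (y := p) fun h => hj (h ▸ rfl)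
        exact ⟨i, rfl⟩

theorem List.ofFn_eq_sort {α : Type*} [LinearOrder α] {l : ℕ} {R : Fin l → α}
    (hR : StrictMono R) : List.ofFn R = (Finset.univ.image R).sort (· ≤ ·) := by
  have h : (List.ofFn R).toFinset = Finset.univ.image R := by
    ext
    simp [List.mem_ofFn]
  rw [← h, eq_comm]
  refine (List.toFinset_sort _ (List.nodup_ofFn.2 hR.injective)).2 ?_
  exact List.pairwise_ofFn.2 fun i j h => hR.monotone h.le

theorem qMinor_eq_setMinor (K : Type) [Field K] (q : K) {u v l : ℕ} {R : Fin l → Fin u}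
    {C : Fin l → Fin v} (hR : StrictMono R) (hC : StrictMono C) :
    qMinor K q R C = setMinor q (Xg K q) (Finset.univ.image R) (Finset.univ.image C) := by
  rw [qMinor_eq_listMinor K q R C hC, List.ofFn_eq_sort hR, setMinor]

theorem listMinor_eq_zero {K B ι κ : Type*} [Field K] [Ring B] [Algebra K B] [LinearOrder κ]
    {q : K} (x : ι → κ → B) {is : List ι} {J : Finset κ} (h : is.length ≠ J.card) :
    listMinor q x is J = 0 := by
  induction is generalizing J with
  | nil =>
    rw [listMinor, if_neg]
    rintro rfl
    simp at h
  | cons i is ih =>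
    rw [listMinor_cons]
    refine Finset.sum_eq_zero fun j hj => ?_
    rw [ih, mul_zero, smul_zero]
    have := Finset.card_erase_add_one hj
    simp only [List.length_cons] at h
    omega

theorem setMinor_eq_zero {K B ι κ : Type*} [Field K] [Ring B] [Algebra K B] [LinearOrder ι]
    [LinearOrder κ] {q : K} (x : ι → κ → B) {I : Finset ι} {J : Finset κ} (h : I.card ≠ J.card) :
    setMinor q x I J = 0 :=
  listMinor_eq_zero x (by simpa using h)

theorem qMinorF_eq_setMinor (K : Type) [Field K] (q : K) {u v : ℕ} (I : Finset (Fin u))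
    (J : Finset (Fin v)) : qMinorF K q I J = setMinor q (Xg K q) I J := by
  rw [qMinorF]
  split_ifs with h
  · rw [qMinor_eq_setMinor]
    · congr 1
      · exact I.image_orderEmbOfFin_univ rfl
      · exact J.image_orderEmbOfFin_univ h.symm
    · exact fun a b hab => (I.orderIsoOfFin rfl).strictMono hab
    · exact fun a b hab => (J.orderIsoOfFin h.symm).strictMono hab
  · rw [setMinor_eq_zero _ h]

end PermutationExpansion

section Laplace

variable {K B B' ι κ : Type*} [Field K] [Ring B] [Algebra K B] [Ring B'] [Algebra K B']
  [LinearOrder κ] {q : K}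

theorem map_listMinor (f : B →ₐ[K] B') (x : ι → κ → B) (is : List ι) (J : Finset κ) :
    f (listMinor q x is J) = listMinor q (fun i j => f (x i j)) is J := by
  induction is generalizing J with
  | nil =>
    simp only [listMinor]
    split_ifs <;> simp
  | cons i is ih => simp only [listMinor_cons, map_sum, map_smul, map_mul, ih]

theorem map_setMinor [LinearOrder ι] (f : B →ₐ[K] B') (x : ι → κ → B) (I : Finset ι)
    (J : Finset κ) : f (setMinor q x I J) = setMinor q (fun i j => f (x i j)) I J :=
  map_listMinor f x _ J

theorem setMinor_eq_zero_of_le [LinearOrder ι] {x : ι → κ → B} {s : ℕ}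
    (h : ∀ I J, I.card = s → setMinor q x I J = 0) {I : Finset ι} (hI : s ≤ I.card)
    (J : Finset κ) : setMinor q x I J = 0 := by
  induction I using Finset.induction_on_min generalizing J with
  | empty => exact h _ _ (by simpa using (hI.antisymm (Nat.zero_le _)).symm)
  | insert i I hi ih =>
    rcases hI.eq_or_lt with h' | h'
    · exact h _ _ h'.symm
    · rw [Finset.card_insert_of_notMem fun h => (hi i h).false, Nat.lt_succ_iff] at h'
      rw [setMinor_insert_left _ hi]
      exact Finset.sum_eq_zero fun j _ => by rw [ih h', mul_zero, smul_zero]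

theorem mkle_setMinor_eq_zero (K : Type) [Field K] (q : K) {m n t : ℕ} {I : Finset (Fin m)}
    (hI : t < I.card) (J : Finset (Fin n)) : mkle K q m n t (setMinor q (Xg K q) I J) = 0 := by
  refine (map_setMinor (B' := OqMle K q m n t) (mkle K q m n t) (Xg K q) I J).trans ?_
  refine setMinor_eq_zero_of_le (s := t + 1) (fun I J hI => ?_) hI J
  by_cases hJ : J.card = t + 1
  · rw [← map_setMinor, ← I.image_orderEmbOfFin_univ hI, ← J.image_orderEmbOfFin_univ hJ,
      ← qMinor_eq_setMinor K q (OrderEmbedding.strictMono _) (OrderEmbedding.strictMono _)]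
    exact (RingQuot.mkAlgHom_rel K (DetRel.minor _ _ (OrderEmbedding.strictMono _)
      (OrderEmbedding.strictMono _))).trans (map_zero _)
  · exact setMinor_eq_zero _ (hI ▸ Ne.symm hJ)

theorem OqMle.exists_lift {K B : Type} [Field K] {q : K} [Ring B] [Algebra K B] {m n t : ℕ}
    (x : Fin m → Fin n → B) (hx : IsQMatrix q x)
    (h : ∀ I J, I.card = t + 1 → setMinor q x I J = 0) :
    ∃ f : OqMle K q m n t →ₐ[K] B, ∀ a, f (mkle K q m n t a) = OqM.lift x hx a := by
  refine ⟨RingQuot.liftAlgHom K ⟨OqM.lift x hx, ?_⟩, fun a => ?_⟩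
  · rintro _ _ ⟨R, C, hR, hC⟩
    rw [qMinor_eq_setMinor K q hR hC, map_setMinor, map_zero]
    simp only [OqM.lift_Xg]
    exact h _ _ (by rw [Finset.card_image_of_injective _ hR.injective]; simp)
  · exact RingQuot.liftAlgHom_mkAlgHom_apply _ _ _ _

end Laplace

section QRows

variable {K B ι κ μ : Type*} [Field K] [Ring B] [Algebra K B] [LinearOrder ι] [LinearOrder κ]
  {q : K}

/-- The relations of a quantum matrix between a row `a` and a lower row `b`. -/
structure IsQRowPair (q : K) (a b : κ → B) : Prop where
  col : ∀ j, a j * b j = q • (b j * a j)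
  comm : ∀ ⦃j l⦄, l < j → a j * b l = b l * a j
  quantum : ∀ ⦃j l⦄, j < l → a j * b l = b l * a j + (q - q⁻¹) • (a l * b j)

theorem IsQMatrix.of_rows {x : ι → κ → B}
    (row : ∀ i, ∀ ⦃j k⦄, j < k → x i j * x i k = q • (x i k * x i j))
    (pair : ∀ ⦃i k⦄, i < k → IsQRowPair q (x i) (x k)) : IsQMatrix q x :=
  ⟨fun i _ _ h => row i h, fun _ _ j h => (pair h).col j, fun _ _ _ _ h h' => (pair h).comm h',
    fun _ _ _ _ h h' => (pair h).quantum h'⟩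

theorem IsQRowPair.sum_mul [Fintype μ] {x : μ → B} {g : μ → κ → B} {y : κ → B}
    (h : ∀ m, IsQRowPair q (g m) y) (hc : ∀ m j, Commute (x m) (y j)) :
    IsQRowPair q (fun j => ∑ m, x m * g m j) y where
  col j := by
    simp only [Finset.sum_mul, Finset.mul_sum, Finset.smul_sum]
    refine Finset.sum_congr rfl fun m _ => ?_
    rw [mul_assoc, (h m).col, ← mul_assoc, ← (hc m j).eq, mul_smul_comm, mul_assoc]
  comm j l hl := by
    simp only [Finset.sum_mul, Finset.mul_sum]
    refine Finset.sum_congr rfl fun m _ => ?_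
    rw [mul_assoc, (h m).comm hl, ← mul_assoc, ← mul_assoc, (hc m l).eq]
  quantum j l hl := by
    simp only [Finset.sum_mul, Finset.mul_sum, Finset.smul_sum]
    rw [← Finset.sum_add_distrib]
    refine Finset.sum_congr rfl fun m _ => ?_
    rw [mul_assoc, (h m).quantum hl, mul_add, ← mul_assoc, ← mul_assoc, (hc m l).eq,
      mul_smul_comm, mul_assoc (x m)]

/-- The lower triangular matrix with entries `y j * H m` for `j ≤ m`. -/
def triMatrix (y H : κ → B) (m j : κ) : B := if j ≤ m then y j * H m else 0

variable {y H : κ → B}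

theorem isQRowPair_triMatrix_left (hq : q ≠ 0) (hy : ∀ ⦃j l⦄, j < l → y j * y l = q • (y l * y j))
    (hle : ∀ ⦃j m⦄, j ≤ m → H m * y j = q • (y j * H m))
    (hlt : ∀ ⦃j m⦄, m < j → H m * y j = q⁻¹ • (y j * H m)) (m : κ) :
    IsQRowPair q (triMatrix y H m) y where
  col j := by
    simp only [triMatrix]
    split_ifs with h
    · rw [mul_assoc, hle h, mul_smul_comm]
    · simp
  comm j l hl := by
    simp only [triMatrix]
    split_ifs with h
    · rw [mul_assoc, hle (hl.le.trans h), mul_smul_comm, ← mul_assoc, ← mul_assoc, hy hl,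
        smul_mul_assoc]
    · simp
  quantum j l hl := by
    simp only [triMatrix]
    by_cases h : l ≤ m
    · rw [if_pos (hl.le.trans h), if_pos h, mul_assoc, mul_assoc, hle h, hle (hl.le.trans h),
        mul_smul_comm, mul_smul_comm, ← mul_assoc, ← mul_assoc, hy hl, smul_mul_assoc]
      match_scalars
      field_simp
      ring
    · rw [if_neg h]
      split_ifs with h'
      · rw [mul_assoc, hlt (not_le.1 h), mul_smul_comm, ← mul_assoc, ← mul_assoc, hy hl,
          smul_mul_assoc, inv_smul_smul₀ hq, zero_mul, smul_zero, add_zero]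
      · simp

theorem triMatrix_row (hy : ∀ ⦃j l⦄, j < l → y j * y l = q • (y l * y j))
    (hle : ∀ ⦃j m⦄, j ≤ m → H m * y j = q • (y j * H m)) (m : κ) ⦃j k : κ⦄ (h : j < k) :
    triMatrix y H m j * triMatrix y H m k =
      q • (triMatrix y H m k * triMatrix y H m j) := by
  simp only [triMatrix]
  by_cases hk : k ≤ m
  · rw [if_pos hk, if_pos (h.le.trans hk), mul_assoc, ← mul_assoc (H m), hle hk, mul_assoc,
      ← mul_assoc (H m), hle (h.le.trans hk)]
    simp only [smul_mul_assoc, mul_smul_comm]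
    rw [← mul_assoc, ← mul_assoc, ← mul_assoc, hy h]
    simp only [smul_mul_assoc, mul_assoc]
  · simp [hk]

theorem triMatrix_mul_triMatrix {c : K} {m n j l : κ} (h1 : j ≤ m) (h2 : l ≤ n)
    (h : H m * y l = c • (y l * H m)) : triMatrix y H m j * triMatrix y H n l =
      c • (y j * y l * (H m * H n)) := by
  rw [triMatrix, triMatrix, if_pos h1, if_pos h2, mul_assoc, ← mul_assoc (H m), h]
  simp only [smul_mul_assoc, mul_smul_comm, mul_assoc]

theorem isQMatrix_triMatrix (hq : q ≠ 0) (hy : ∀ ⦃j l⦄, j < l → y j * y l = q • (y l * y j))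
    (hH : ∀ ⦃m n⦄, m < n → H m * H n = q • (H n * H m))
    (hle : ∀ ⦃j m⦄, j ≤ m → H m * y j = q • (y j * H m))
    (hlt : ∀ ⦃j m⦄, m < j → H m * y j = q⁻¹ • (y j * H m)) :
    IsQMatrix q (triMatrix y H) := by
  refine IsQMatrix.of_rows (triMatrix_row hy hle) fun m n hmn => ⟨fun j => ?_, fun j l hl => ?_,
    fun j l hl => ?_⟩
  · by_cases h : j ≤ m
    · rw [triMatrix_mul_triMatrix h (h.trans hmn.le) (hle h),
        triMatrix_mul_triMatrix (h.trans hmn.le) h (hle (h.trans hmn.le)), hH hmn, mul_smul_comm]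
    · simp [triMatrix, h]
  · by_cases h : j ≤ m
    · have h' := hl.le.trans h
      rw [triMatrix_mul_triMatrix h (h'.trans hmn.le) (hle h'),
        triMatrix_mul_triMatrix (h'.trans hmn.le) h (hle (h.trans hmn.le)), hH hmn, hy hl,
        mul_smul_comm, smul_mul_assoc]
    · simp [triMatrix, h]
  · by_cases h : l ≤ m
    · have h' := hl.le.trans h
      rw [triMatrix_mul_triMatrix h' (h.trans hmn.le) (hle h),
        triMatrix_mul_triMatrix (h.trans hmn.le) h' (hle (h'.trans hmn.le)),
        triMatrix_mul_triMatrix h (h'.trans hmn.le) (hle h'), hH hmn, hy hl]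
      simp only [mul_smul_comm, smul_mul_assoc]
      match_scalars
      field_simp
      ring
    · have h0 : triMatrix y H m l = 0 := if_neg h
      rw [h0, zero_mul, smul_zero, add_zero]
      by_cases h1 : j ≤ m
      · by_cases h2 : l ≤ n
        · rw [triMatrix_mul_triMatrix h1 h2 (hlt (not_le.1 h)),
            triMatrix_mul_triMatrix h2 h1 (hle (h1.trans hmn.le)), hH hmn, hy hl]
          simp only [mul_smul_comm, smul_mul_assoc]
          rw [inv_smul_smul₀ hq]
        · simp [triMatrix, h2]
      · simp [triMatrix, h1]

end QRows

section MonomialOperators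

variable {K Γ : Type*} [Field K] [AddCommGroup Γ] {q : K}

/-- The operator sending the basis vector at `e` to `q ^ φ e` times the one at `e + a`. -/
def monOp (q : K) (a : Γ) (φ : Γ →+ ℤ) : Module.End K (Γ →₀ K) :=
  Finsupp.linearCombination K fun e => Finsupp.single (e + a) (q ^ φ e)

theorem monOp_single (a : Γ) (φ : Γ →+ ℤ) (e : Γ) :
    monOp q a φ (Finsupp.single e 1) = Finsupp.single (e + a) (q ^ φ e) := by
  simp [monOp]

theorem monOp_mul (hq : q ≠ 0) (a b : Γ) (φ ψ : Γ →+ ℤ) :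
    monOp q a φ * monOp q b ψ = q ^ φ b • monOp q (a + b) (φ + ψ) := by
  refine Finsupp.lhom_ext' fun e => LinearMap.ext_ring ?_
  have h : Finsupp.single (e + b) (q ^ ψ e) = q ^ ψ e • Finsupp.single (e + b) (1 : K) := by simp
  simp only [LinearMap.comp_apply, Finsupp.lsingle_apply, Module.End.mul_apply, monOp_single,
    LinearMap.smul_apply]
  rw [h, map_smul, monOp_single, Finsupp.smul_single, Finsupp.smul_single, add_assoc, add_comm b]
  congr 1
  simp only [map_add, smul_eq_mul, AddMonoidHom.add_apply, zpow_add₀ hq]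
  ring

theorem monOp_mul_eq_smul (hq : q ≠ 0) (a b : Γ) (φ ψ : Γ →+ ℤ) :
    monOp q a φ * monOp q b ψ = q ^ (φ b - ψ a) • (monOp q b ψ * monOp q a φ) := by
  rw [monOp_mul hq, monOp_mul hq, smul_smul, ← zpow_add₀ hq, sub_add_cancel, add_comm a,
    add_comm φ]

theorem monOp_commute (hq : q ≠ 0) {a b : Γ} {φ ψ : Γ →+ ℤ} (h : φ b = ψ a) :
    Commute (monOp q a φ) (monOp q b ψ) := by
  rw [Commute, SemiconjBy, monOp_mul_eq_smul hq, h, sub_self, zpow_zero, one_smul]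

end MonomialOperators

section Lead

variable {K Γ : Type*} [Field K] [AddCommGroup Γ] {F : Γ →+ ℤ} {T S : Module.End K (Γ →₀ K)}
  {a b : Γ} {r s : ℤ}

/-- `T` shifts basis vectors by `a` with nonzero coefficient, up to terms lower for `F`. -/
def HasLead (F : Γ →+ ℤ) (T : Module.End K (Γ →₀ K)) (a : Γ) : Prop :=
  ∀ e, ∃ c : K, c ≠ 0 ∧ T (Finsupp.single e 1) - c • Finsupp.single (e + a) 1 ∈
    Finsupp.supported K K {e' | F e' < F e + F a}

/-- `T` raises the `F`-degree by less than `r`. -/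
def IsLow (F : Γ →+ ℤ) (T : Module.End K (Γ →₀ K)) (r : ℤ) : Prop :=
  ∀ e, T (Finsupp.single e 1) ∈ Finsupp.supported K K {e' | F e' < F e + r}

theorem supported_lt_mono (h : r ≤ s) : Finsupp.supported K K {e | F e < r} ≤
    Finsupp.supported K K {e | F e < s} :=
  Finsupp.supported_mono fun _ he => lt_of_lt_of_le he h

theorem HasLead.isLow (h : HasLead F T a) (hr : F a < r) : IsLow F T r := by
  intro e
  obtain ⟨c, -, hc⟩ := h e
  have h1 : c • Finsupp.single (e + a) (1 : K) ∈ Finsupp.supported K K {e' | F e' < F e + r} :=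
    Submodule.smul_mem _ _ (Finsupp.single_mem_supported K _ (by simpa using hr))
  simpa using Submodule.add_mem _ (supported_lt_mono (by omega) hc) h1

theorem IsLow.apply_mem (h : IsLow F T r) {w : Γ →₀ K}
    (hw : w ∈ Finsupp.supported K K {e | F e < s}) :
    T w ∈ Finsupp.supported K K {e | F e < s + r - 1} := by
  rw [← w.sum_single, Finsupp.sum, map_sum]
  refine Submodule.sum_mem _ fun e he => ?_
  have hs : Finsupp.single e (w e) = w e • Finsupp.single e (1 : K) := by simp
  have hes : F e < s := hw he
  rw [hs, map_smul]
  exact Submodule.smul_mem _ _ (supported_lt_mono (by omega) (h e))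

theorem HasLead.mul (hT : HasLead F T a) (hS : HasLead F S b) : HasLead F (T * S) (a + b) := by
  intro e
  obtain ⟨c, hc, h⟩ := hS e
  obtain ⟨d, hd, h'⟩ := hT (e + b)
  refine ⟨c * d, mul_ne_zero hc hd, ?_⟩
  have h1 := (hT.isLow (lt_add_one (F a))).apply_mem h
  have h2 := Submodule.smul_mem _ c h'
  rw [map_sub, map_smul] at h1
  have h3 := Submodule.add_mem _ (supported_lt_mono (s := F e + F (a + b)) (by simp; omega) h1)
    (supported_lt_mono (s := F e + F (a + b)) (by simp; omega) h2)
  rw [smul_sub, sub_add_sub_cancel, smul_smul, add_assoc, add_comm b] at h3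
  exact h3

theorem isLow_zero : IsLow F (0 : Module.End K (Γ →₀ K)) r := fun _ => by simp

theorem HasLead.smul (h : HasLead F T a) {c : K} (hc : c ≠ 0) : HasLead F (c • T) a := by
  intro e
  obtain ⟨d, hd, h⟩ := h e
  refine ⟨c * d, mul_ne_zero hc hd, ?_⟩
  rw [LinearMap.smul_apply, mul_smul, ← smul_sub]
  exact Submodule.smul_mem _ _ h

theorem HasLead.sum {α : Type*} {s : Finset α} {T : α → Module.End K (Γ →₀ K)} {i : α}
    (hi : i ∈ s) (h : HasLead F (T i) a) (hs : ∀ k ∈ s, k ≠ i → IsLow F (T k) (F a)) :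
    HasLead F (∑ k ∈ s, T k) a := by
  classical
  intro e
  obtain ⟨c, hc, h⟩ := h e
  refine ⟨c, hc, ?_⟩
  rw [← Finset.add_sum_erase _ _ hi, LinearMap.add_apply, add_sub_right_comm, LinearMap.sum_apply]
  refine Submodule.add_mem _ h (Submodule.sum_mem _ fun k hk => ?_)
  exact hs k (Finset.mem_of_mem_erase hk) (Finset.ne_of_mem_erase hk) e

theorem hasLead_one : HasLead F (1 : Module.End K (Γ →₀ K)) 0 := fun e =>
  ⟨1, one_ne_zero, by simp⟩

theorem hasLead_monOp {q : K} (hq : q ≠ 0) (φ : Γ →+ ℤ) : HasLead F (monOp q a φ) a := fun e =>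
  ⟨q ^ φ e, zpow_ne_zero _ hq, by simp [monOp_single]⟩

theorem HasLead.list_prod {α : Type*} {T : α → Module.End K (Γ →₀ K)} {a : α → Γ} {l : List α}
    (h : ∀ i ∈ l, HasLead F (T i) (a i)) : HasLead F (l.map T).prod (l.map a).sum := by
  induction l with
  | nil => exact hasLead_one
  | cons i l ih =>
    simp only [List.map_cons, List.prod_cons, List.sum_cons]
    exact (h i (by simp)).mul (ih fun k hk => h k (by simp [hk]))

/-- Operators with distinct leading shifts are linearly independent. -/
theorem linearIndependent_of_hasLead {α : Type*} {T : α → Module.End K (Γ →₀ K)} {a : α → Γ}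
    (ha : Function.Injective a) (h : ∀ i, HasLead F (T i) (a i)) : LinearIndependent K T := by
  refine LinearIndependent.of_comp (LinearMap.applyₗ (Finsupp.single (0 : Γ) (1 : K))) ?_
  rw [linearIndependent_iff]
  intro g hg
  by_contra hne
  obtain ⟨i, hi, hmax⟩ := g.support.exists_max_image (fun i => F (a i))
    (Finsupp.support_nonempty_iff.2 hne)
  have h0 := DFunLike.congr_fun hg (a i)
  rw [Finsupp.linearCombination_apply, Finsupp.sum, Finsupp.finsetSum_apply,
    Finset.sum_eq_single_of_mem i hi] at h0
  · obtain ⟨c, hc, hmem⟩ := h i 0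
    have h1 := Finsupp.notMem_support_iff.1 fun hs : a i ∈ _ => by
      have := hmem hs
      simp at this
    rw [Finsupp.sub_apply, sub_eq_zero] at h1
    simp only [Function.comp, LinearMap.applyₗ_apply_apply, Finsupp.smul_apply, h1] at h0
    simp [hc, Finsupp.mem_support_iff.1 hi] at h0
  · intro k hk hki
    obtain ⟨c, hc, hmem⟩ := h k 0
    have h1 := Finsupp.notMem_support_iff.1 fun hs : a i ∈ _ => by
      have := hmem hs
      simp only [map_zero, zero_add, Set.mem_ofPred_eq] at this
      exact this.not_ge (hmax k hk)
    rw [Finsupp.sub_apply, sub_eq_zero] at h1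
    simp only [Function.comp, LinearMap.applyₗ_apply_apply, Finsupp.smul_apply, h1]
    simp [ha.ne hki]

end Lead

section Representation

variable {K : Type*} [Field K] {q : K}

/-- The lattice of exponents of monomial operators. -/
abbrev ExpLattice : Type := ℕ × ℕ × ℕ →₀ ℤ

/-- The unit vector with label `(τ, i, j)`. -/
def eps (τ i j : ℕ) : ExpLattice := Finsupp.single (τ, i, j) 1

/-- The coordinate with label `(τ, i, j)`. -/
def crd (τ i j : ℕ) : ExpLattice →+ ℤ := Finsupp.applyAddHom (τ, i, j)

theorem crd_eps (τ i j τ' i' j' : ℕ) :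
    crd τ i j (eps τ' i' j') = if τ' = τ ∧ i' = i ∧ j' = j then 1 else 0 := by
  simp [crd, eps, Finsupp.single_apply]

/-- Minus the sum of the coordinates in row `i` before column `j`. -/
def rowPhi (τ i j : ℕ) : ExpLattice →+ ℤ := -∑ k ∈ Finset.range j, crd τ i k

theorem rowPhi_eps (τ i j τ' i' j' : ℕ) :
    rowPhi τ i j (eps τ' i' j') = if τ' = τ ∧ i' = i ∧ j' < j then -1 else 0 := by
  simp only [rowPhi, AddMonoidHom.neg_apply, AddMonoidHom.finsetSum_apply, crd_eps]
  by_cases h : τ' = τ ∧ i' = i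
  · simp [h.1, h.2]
    split_ifs <;> rfl
  · rw [if_neg fun h' => h ⟨h'.1, h'.2.1⟩, Finset.sum_eq_zero, neg_zero]
    exact fun k _ => if_neg fun h' => h ⟨h'.1, h'.2.1⟩

/-- The entries of a row of `q`-commuting monomial operators. -/
def yOp (q : K) (τ i j : ℕ) : Module.End K (ExpLattice →₀ K) := monOp q (eps τ i j) (rowPhi τ i j)

/-- Operators `q`-commuting with the row `yOp q τ i`. -/
def hOp (q : K) (τ i j : ℕ) : Module.End K (ExpLattice →₀ K) :=
  monOp q (-eps τ i j) (crd τ i j - rowPhi τ i j)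

theorem yOp_mul (hq : q ≠ 0) (τ i : ℕ) {j l : ℕ} (h : j < l) :
    yOp q τ i j * yOp q τ i l = q • (yOp q τ i l * yOp q τ i j) := by
  rw [yOp, yOp, monOp_mul_eq_smul hq, rowPhi_eps, rowPhi_eps, if_neg (by simp [h.le]),
    if_pos (by simp [h])]
  simp

theorem hOp_mul (hq : q ≠ 0) (τ i : ℕ) {m n : ℕ} (h : m < n) :
    hOp q τ i m * hOp q τ i n = q • (hOp q τ i n * hOp q τ i m) := by
  rw [hOp, hOp, monOp_mul_eq_smul hq]
  simp [rowPhi_eps, crd_eps, h, h.not_gt, h.ne, h.ne']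

theorem hOp_mul_yOp_of_le (hq : q ≠ 0) (τ i : ℕ) {j m : ℕ} (h : j ≤ m) :
    hOp q τ i m * yOp q τ i j = q • (yOp q τ i j * hOp q τ i m) := by
  rw [hOp, yOp, monOp_mul_eq_smul hq]
  rcases h.eq_or_lt with rfl | h
  · simp [rowPhi_eps, crd_eps]
  · simp [rowPhi_eps, crd_eps, h, h.not_gt, h.ne]

theorem hOp_mul_yOp_of_lt (hq : q ≠ 0) (τ i : ℕ) {j m : ℕ} (h : m < j) :
    hOp q τ i m * yOp q τ i j = q⁻¹ • (yOp q τ i j * hOp q τ i m) := by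
  rw [hOp, yOp, monOp_mul_eq_smul hq]
  simp [rowPhi_eps, crd_eps, h, h.not_gt, h.ne']

/-- `T` commutes with the row operators labelled `(τ, i)`. -/
def CommutesWithRow (q : K) (T : Module.End K (ExpLattice →₀ K)) (τ i : ℕ) : Prop :=
  ∀ j, Commute T (yOp q τ i j) ∧ Commute T (hOp q τ i j)

theorem commutesWithRow_yOp (hq : q ≠ 0) {τ i τ' i' : ℕ} (h : (τ, i) ≠ (τ', i')) (j : ℕ) :
    CommutesWithRow q (yOp q τ i j) τ' i' := by
  have h1 : ¬(τ = τ' ∧ i = i') := by simpa using h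
  have h2 : ¬(τ' = τ ∧ i' = i) := fun h => h1 ⟨h.1.symm, h.2.symm⟩
  refine fun l => ⟨monOp_commute hq ?_, monOp_commute hq ?_⟩ <;>
    simp [rowPhi_eps, crd_eps, ← and_assoc, h1, h2]

theorem commutesWithRow_hOp (hq : q ≠ 0) {τ i τ' i' : ℕ} (h : (τ, i) ≠ (τ', i')) (j : ℕ) :
    CommutesWithRow q (hOp q τ i j) τ' i' := by
  have h1 : ¬(τ = τ' ∧ i = i') := by simpa using h
  have h2 : ¬(τ' = τ ∧ i' = i) := fun h => h1 ⟨h.1.symm, h.2.symm⟩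
  refine fun l => ⟨monOp_commute hq ?_, monOp_commute hq ?_⟩ <;>
    simp [rowPhi_eps, crd_eps, ← and_assoc, h1, h2]

/-- The triangular quantum matrix attached to row `i`. -/
def rowTri (q : K) (τ i w : ℕ) : Fin w → Fin w → Module.End K (ExpLattice →₀ K) :=
  triMatrix (fun j : Fin w => yOp q τ i j) fun j => hOp q τ i j

/-- A `u × w` quantum matrix of operators on the space spanned by `ExpLattice`. -/
def opMatrix (q : K) (τ w : ℕ) : (u : ℕ) → Fin u → Fin w → Module.End K (ExpLattice →₀ K)
  | 0 => Fin.elim0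
  | u + 1 => Fin.snoc (fun i j => ∑ m, opMatrix q τ w u i m * rowTri q τ u w m j)
      fun j => yOp q τ u j

theorem opMatrix_castSucc (q : K) (τ w u : ℕ) (i : Fin u) (j : Fin w) :
    opMatrix q τ w (u + 1) i.castSucc j =
      ∑ m, opMatrix q τ w u i m * rowTri q τ u w m j := by
  rw [opMatrix, Fin.snoc_castSucc]

theorem opMatrix_last (q : K) (τ w u : ℕ) (j : Fin w) :
    opMatrix q τ w (u + 1) (Fin.last u) j = yOp q τ u j := by
  rw [opMatrix, Fin.snoc_last]

theorem commute_rowTri {T : Module.End K (ExpLattice →₀ K)} {τ i : ℕ}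
    (h : CommutesWithRow q T τ i) {w : ℕ} (m j : Fin w) : Commute T (rowTri q τ i w m j) := by
  rw [rowTri, triMatrix]
  split_ifs
  · exact (h j).1.mul_right (h m).2
  · exact Commute.zero_right _

theorem commute_opMatrix {T : Module.End K (ExpLattice →₀ K)} {τ w u : ℕ}
    (h : ∀ r < u, CommutesWithRow q T τ r) (i : Fin u) (j : Fin w) :
    Commute T (opMatrix q τ w u i j) := by
  induction u generalizing j with
  | zero => exact i.elim0
  | succ u ih =>
    refine Fin.lastCases ?_ (fun i => ?_) i
    · rw [opMatrix_last]
      exact (h u u.lt_succ_self j).1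
    · rw [opMatrix_castSucc]
      refine Commute.sum_right _ _ _ fun m _ => ?_
      exact (ih (fun r hr => h r (hr.trans u.lt_succ_self)) i m).mul_right
        (commute_rowTri (h u u.lt_succ_self) m j)

theorem commutesWithRow_opMatrix (hq : q ≠ 0) {τ τ' w u r : ℕ} (h : ∀ i < u, (τ', r) ≠ (τ, i))
    (i : Fin u) (j : Fin w) : CommutesWithRow q (opMatrix q τ w u i j) τ' r := fun l =>
  ⟨(commute_opMatrix (fun k hk => commutesWithRow_yOp hq (h k hk) l) i j).symm,
    (commute_opMatrix (fun k hk => commutesWithRow_hOp hq (h k hk) l) i j).symm⟩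

theorem commute_opMatrix_opMatrix (hq : q ≠ 0) {τ τ' : ℕ} (h : τ ≠ τ') {w u w' u' : ℕ} (i : Fin u)
    (j : Fin w) (i' : Fin u') (j' : Fin w') :
    Commute (opMatrix q τ w u i j) (opMatrix q τ' w' u' i' j') :=
  commute_opMatrix (fun r _ => commutesWithRow_opMatrix hq (by simp [h.symm]) i j) i' j'

theorem isQMatrix_opMatrix (hq : q ≠ 0) (τ w u : ℕ) : IsQMatrix q (opMatrix q τ w u) := by
  induction u with
  | zero => exact IsQMatrix.of_rows (fun i => i.elim0) fun i => i.elim0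
  | succ u ih =>
    have hy : ∀ ⦃j l : Fin w⦄, j < l → yOp q τ u j * yOp q τ u l =
        q • (yOp q τ u l * yOp q τ u j) := fun j l h => yOp_mul hq τ u h
    have hle : ∀ ⦃j m : Fin w⦄, j ≤ m → hOp q τ u m * yOp q τ u j =
        q • (yOp q τ u j * hOp q τ u m) := fun j m h => hOp_mul_yOp_of_le hq τ u h
    have hlt : ∀ ⦃j m : Fin w⦄, m < j → hOp q τ u m * yOp q τ u j =
        q⁻¹ • (yOp q τ u j * hOp q τ u m) := fun j m h => hOp_mul_yOp_of_lt hq τ u h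
    have hg : IsQMatrix q (rowTri q τ u w) :=
      isQMatrix_triMatrix hq hy (fun m n h => hOp_mul hq τ u h) hle hlt
    have hc : ∀ (i : Fin u) (m : Fin w), CommutesWithRow q (opMatrix q τ w u i m) τ u := fun i m =>
      commutesWithRow_opMatrix hq (fun k hk => by simp [hk.ne']) i m
    have hxg := ih.mul hq hg fun i m m' j => commute_rowTri (hc i m) m' j
    refine IsQMatrix.of_rows (fun i j k h => ?_) fun i k => ?_
    · induction i using Fin.lastCases with
      | last => simpa only [opMatrix_last] using hy h
      | cast i => simpa only [opMatrix_castSucc] using hxg.row h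
    · induction k using Fin.lastCases with
      | last =>
        induction i using Fin.lastCases with
        | last => exact fun h => (lt_irrefl _ h).elim
        | cast i =>
          intro _
          have : IsQRowPair q (fun j => ∑ m, opMatrix q τ w u i m * rowTri q τ u w m j)
              fun j : Fin w => yOp q τ u j :=
            IsQRowPair.sum_mul (isQRowPair_triMatrix_left hq hy hle hlt) fun m j => (hc i m j).1
          rwa [← funext (opMatrix_castSucc q τ w u i), ← funext (opMatrix_last q τ w u)] at this
      | cast k =>
        induction i using Fin.lastCases with
        | last => exact fun h => ((Fin.castSucc_lt_last k).not_gt h).elim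
        | cast i =>
          intro h
          have h' : i < k := h
          constructor <;> intros <;> simp only [opMatrix_castSucc]
          · exact hxg.col h'
          · exact hxg.comm h' ‹_›
          · exact hxg.quantum h' ‹_›

theorem hasLead_opMatrix (hq : q ≠ 0) {F : ExpLattice →+ ℤ} {τ : ℕ}
    (hF : ∀ ⦃i k j l⦄, i < k → j < l →
      F (eps τ i l) + F (eps τ k j) < F (eps τ i j) + F (eps τ k l)) {w u : ℕ} (i : Fin u)
    (j : Fin w) : HasLead F (opMatrix q τ w u i j) (eps τ i j) := by
  induction u generalizing j with
  | zero => exact i.elim0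
  | succ u ih =>
    induction i using Fin.lastCases with
    | last =>
      rw [opMatrix_last]
      exact hasLead_monOp hq _
    | cast i =>
      have h1 : ∀ m, j ≤ m → HasLead F (opMatrix q τ w u i m * rowTri q τ u w m j)
          (eps τ i m + (eps τ u j + -eps τ u m)) := by
        intro m hm
        rw [rowTri, triMatrix, if_pos hm]
        exact (ih i m).mul ((hasLead_monOp hq _).mul (hasLead_monOp hq _))
      rw [opMatrix_castSucc]
      refine HasLead.sum (Finset.mem_univ j) (by simpa using h1 j le_rfl) fun m _ hm => ?_
      rcases hm.lt_or_gt with h | h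
      · rw [rowTri, triMatrix, if_neg h.not_ge, mul_zero]
        exact isLow_zero
      · refine (h1 m h.le).isLow ?_
        have := hF (i := i) (k := u) (j := j) (l := m) i.2 h
        simp only [map_add, map_neg, Fin.val_castSucc]
        omega

end Representation

section MinorLead

theorem List.zipWith_erase_sum_lt {ι κ : Type*} [LinearOrder ι] [LinearOrder κ] {f : ι → κ → ℤ}
    (hf : ∀ ⦃i k j l⦄, i < k → j < l → f i l + f k j < f i j + f k l) {i : ι} {is : List ι}
    {j l : κ} {js : List κ} (his : (i :: is).Pairwise (· < ·)) (hjs : (j :: js).Pairwise (· < ·))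
    (hl : l ∈ js) (h : is.length = js.length) :
    f i l + (List.zipWith f is ((j :: js).erase l)).sum < f i j + (List.zipWith f is js).sum := by
  induction js generalizing i is j with
  | nil => simp at hl
  | cons j' js ih =>
    obtain _ | ⟨k, is⟩ := is
    · simp at h
    have hik : i < k := (List.pairwise_cons.1 his).1 k (by simp)
    have hjl : j < l := (List.pairwise_cons.1 hjs).1 l hl
    rw [List.erase_cons_tail (by simpa using hjl.ne)]
    have h1 := hf hik hjl
    rcases List.mem_cons.1 hl with rfl | hl'
    · simp only [List.erase_cons_head, List.zipWith_cons_cons, List.sum_cons]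
      omega
    · have h2 := ih his.of_cons hjs.of_cons hl' (by simpa using h)
      simp only [List.zipWith_cons_cons, List.sum_cons]
      omega

variable {K Γ ι κ : Type*} [Field K] [AddCommGroup Γ] [LinearOrder ι] [LinearOrder κ] {q : K}
  {F : Γ →+ ℤ} {x : ι → κ → Module.End K (Γ →₀ K)} {ε : ι → κ → Γ}

theorem hasLead_listMinor (hq : q ≠ 0) (hx : ∀ i j, HasLead F (x i j) (ε i j))
    (hF : ∀ ⦃i k j l⦄, i < k → j < l → F (ε i l) + F (ε k j) < F (ε i j) + F (ε k l))
    {is : List ι} {js : List κ} (his : is.Pairwise (· < ·)) (hjs : js.Pairwise (· < ·))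
    (h : is.length = js.length) :
    HasLead F (listMinor q x is js.toFinset) (List.zipWith ε is js).sum := by
  induction is generalizing js with
  | nil =>
    obtain rfl : js = [] := List.eq_nil_of_length_eq_zero h.symm
    exact hasLead_one
  | cons i is ih =>
    obtain _ | ⟨j, js⟩ := js
    · simp at h
    have hlead : ∀ l ∈ j :: js, HasLead F (x i l * listMinor q x is ((j :: js).toFinset.erase l))
        (ε i l + (List.zipWith ε is ((j :: js).erase l)).sum) := by
      intro l hl
      have hs : (j :: js).toFinset.erase l = ((j :: js).erase l).toFinset := by
        have hnd : (j :: js).Nodup := hjs.imp fun h => h.ne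
        ext a
        simp only [Finset.mem_erase, List.mem_toFinset, hnd.mem_erase_iff]
      rw [hs]
      refine (hx i l).mul (ih his.of_cons (hjs.sublist List.erase_sublist) ?_)
      rw [List.length_erase_of_mem hl]
      simpa using h
    have hsmul : ∀ l : κ, (-q) ^ ((j :: js).toFinset.filter (· < l)).card ≠ 0 := fun l =>
      pow_ne_zero _ (neg_ne_zero.2 hq)
    rw [listMinor_cons, List.zipWith_cons_cons, List.sum_cons]
    refine HasLead.sum (i := j) (by simp) ?_ fun l hl hlj => ?_
    · simpa using (hlead j (by simp)).smul (hsmul j)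
    · have hl' : l ∈ j :: js := by simpa using hl
      have hl'' : l ∈ js := by simpa [hlj] using hl
      refine ((hlead l hl').smul (hsmul l)).isLow ?_
      have := List.zipWith_erase_sum_lt (f := fun i j => F (ε i j)) hF his hjs hl'' (by simpa using h)
      simpa only [map_add, map_list_sum, List.map_zipWith] using this

theorem hasLead_setMinor (hq : q ≠ 0) (hx : ∀ i j, HasLead F (x i j) (ε i j))
    (hF : ∀ ⦃i k j l⦄, i < k → j < l → F (ε i l) + F (ε k j) < F (ε i j) + F (ε k l)) {c : ℕ}
    {R : Fin c → ι} {C : Fin c → κ} (hR : StrictMono R) (hC : StrictMono C) :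
    HasLead F (setMinor q x (Finset.univ.image R) (Finset.univ.image C))
      (∑ s, ε (R s) (C s)) := by
  have hC' : Finset.univ.image C = (List.ofFn C).toFinset := by
    ext
    simp
  rw [setMinor, ← List.ofFn_eq_sort hR, hC']
  convert hasLead_listMinor hq hx hF (List.pairwise_ofFn.2 fun _ _ h => hR h)
    (List.pairwise_ofFn.2 fun _ _ h => hC h) (by simp)
  rw [← List.sum_ofFn]
  congr 1
  refine List.ext_getElem (by simp) fun i h1 h2 => by simp

end MinorLead

section StrictMonoFin

theorem StrictMono.le_fin_apply {c w : ℕ} {f : Fin c → Fin w} (hf : StrictMono f) (s : Fin c) :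
    (s : ℕ) ≤ f s := by
  obtain ⟨s, hs⟩ := s
  induction s with
  | zero => exact Nat.zero_le _
  | succ s ih =>
    have h : f ⟨s, by omega⟩ < f ⟨s + 1, hs⟩ := hf (by simp)
    exact (ih (by omega)).trans_lt h

theorem StrictMono.rev_comp_rev {c w : ℕ} {f : Fin c → Fin w} (hf : StrictMono f) :
    StrictMono fun s : Fin c => (f s.rev).rev := fun _ _ h => Fin.rev_lt_rev.2 (hf (Fin.rev_lt_rev.2 h))

theorem StrictMono.fin_apply_le {c w : ℕ} {f : Fin c → Fin w} (hf : StrictMono f) (s : Fin c) :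
    (f s : ℕ) ≤ w - c + s := by
  have h := hf.rev_comp_rev.le_fin_apply s.rev
  simp only [Fin.rev_rev, Fin.val_rev] at h
  have := (f s).2
  omega

theorem image_image_rev {c w : ℕ} (f : Fin c → Fin w) :
    (Finset.univ.image f).image Fin.rev = Finset.univ.image fun s : Fin c => (f s.rev).rev := by
  ext x
  simp only [Finset.mem_image, Finset.mem_univ, true_and, exists_exists_eq_and]
  exact ⟨fun ⟨a, ha⟩ => ⟨a.rev, by simpa using ha⟩, fun ⟨a, ha⟩ => ⟨a.rev, by simpa using ha⟩⟩

/-- The number of elements of `J` below `n`. -/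
def countBelow {v : ℕ} (J : Finset (Fin v)) (n : ℕ) : ℕ := (J.filter fun x : Fin v => x.1 < n).card

theorem lt_countBelow_image_iff {c v : ℕ} {C : Fin c → Fin v} (hC : StrictMono C) (s n : ℕ) :
    s < countBelow (Finset.univ.image C) n ↔ ∃ h : s < c, (C ⟨s, h⟩ : ℕ) < n := by
  have h0 : countBelow (Finset.univ.image C) n =
      (Finset.univ.filter fun s : Fin c => (C s : ℕ) < n).card := by
    rw [countBelow, Finset.filter_image, Finset.card_image_of_injective _ hC.injective]
  rw [h0]
  constructor
  · intro h
    have hs : s < c := h.trans_le ((Finset.card_filter_le _ _).trans (by simp))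
    refine ⟨hs, ?_⟩
    by_contra hn
    refine h.not_ge (le_of_le_of_eq (Finset.card_le_card (t := Finset.Iio ⟨s, hs⟩) fun a ha => ?_)
      (Fin.card_Iio _))
    rw [Finset.mem_Iio]
    by_contra hsa
    have h1 : (C ⟨s, hs⟩ : ℕ) ≤ C a := hC.monotone (not_lt.1 hsa)
    exact hn (h1.trans_lt (Finset.mem_filter.1 ha).2)
  · rintro ⟨hs, h⟩
    refine lt_of_lt_of_le (lt_of_lt_of_eq s.lt_succ_self (Fin.card_Iic ⟨s, hs⟩).symm)
      (Finset.card_le_card fun a ha => ?_)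
    have h1 : (C a : ℕ) ≤ C ⟨s, hs⟩ := hC.monotone (Finset.mem_Iic.1 ha)
    exact Finset.mem_filter.2 ⟨Finset.mem_univ _, h1.trans_lt h⟩

theorem Finset.sum_fin_ite_eq {c : ℕ} (s : ℕ) (p : Fin c → Prop) [DecidablePred p]
    [Decidable (∃ h : s < c, p ⟨s, h⟩)] :
    (∑ k : Fin c, if (k : ℕ) = s ∧ p k then (1 : ℤ) else 0) =
      if ∃ h : s < c, p ⟨s, h⟩ then 1 else 0 := by
  split_ifs with h
  · obtain ⟨hs, hp⟩ := h
    rw [Finset.sum_eq_single (⟨s, hs⟩ : Fin c)]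
    · simp [hp]
    · exact fun b _ hb => if_neg fun h' => hb (Fin.ext h'.1)
    · simp
  · refine Finset.sum_eq_zero fun k _ => if_neg ?_
    rintro ⟨rfl, hp⟩
    exact h ⟨k.2, hp⟩

end StrictMonoFin

section TripleProduct

variable {K : Type*} [Field K] {q : K}

/-- The weight of the coordinate labelled `(τ, i, j)`, for a bound `B` on the column indices. -/
def labelWeight (B : ℤ) (p : ℕ × ℕ × ℕ) : ℤ :=
  if p.1 = 0 then (p.2.1 + 1) * p.2.2 else
    if p.1 = 1 then p.2.1 * p.2.2 else p.2.1 * (p.2.2 - B)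

/-- The linear form on `ExpLattice` with the weights `labelWeight B`. -/
def leadForm (B : ℤ) : ExpLattice →+ ℤ :=
  Finsupp.liftAddHom fun p => AddMonoidHom.mulRight (labelWeight B p)

theorem leadForm_eps (B : ℤ) (τ i j : ℕ) : leadForm B (eps τ i j) = labelWeight B (τ, i, j) := by
  simp [leadForm, eps]

theorem leadForm_supermodular (B : ℤ) (τ : ℕ) ⦃i k j l : ℕ⦄ (h : i < k) (h' : j < l) :
    leadForm B (eps τ i l) + leadForm B (eps τ k j) <
      leadForm B (eps τ i j) + leadForm B (eps τ k l) := by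
  have h1 : (i : ℤ) < k := by exact_mod_cast h
  have h2 : (j : ℤ) < l := by exact_mod_cast h'
  simp only [leadForm_eps, labelWeight]
  split_ifs <;> nlinarith [mul_pos (sub_pos.2 h1) (sub_pos.2 h2)]

/-- The product of a `u × w`, a `w × w` and a `w × v` quantum matrix of commuting operators. -/
def tripleMatrix (q : K) (w u v : ℕ) (i : Fin u) (j : Fin v) : Module.End K (ExpLattice →₀ K) :=
  ∑ m, (∑ l, opMatrix q 0 w u i l * opMatrix q 1 w w l m) * opMatrix q 2 v w m j

theorem commute_mul_opMatrix (hq : q ≠ 0) (w u v : ℕ) (i : Fin u) (m m' : Fin w) (j : Fin v) :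
    Commute (∑ l, opMatrix q 0 w u i l * opMatrix q 1 w w l m) (opMatrix q 2 v w m' j) :=
  Commute.sum_left _ _ _ fun l _ =>
    (commute_opMatrix_opMatrix hq (by decide) i l m' j).mul_left
      (commute_opMatrix_opMatrix hq (by decide) l m m' j)

theorem isQMatrix_tripleMatrix (hq : q ≠ 0) (w u v : ℕ) : IsQMatrix q (tripleMatrix q w u v) :=
  ((isQMatrix_opMatrix hq 0 w u).mul hq (isQMatrix_opMatrix hq 1 w w) fun i m m' j =>
      commute_opMatrix_opMatrix hq (by decide) i m m' j).mul hq (isQMatrix_opMatrix hq 2 v w)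
    (commute_mul_opMatrix hq w u v)

theorem setMinor_tripleMatrix (hq : q ≠ 0) (w : ℕ) {u v : ℕ} (I : Finset (Fin u))
    (J : Finset (Fin v)) : setMinor q (tripleMatrix q w u v) I J =
      ∑ p : Finset (Fin w) × Finset (Fin w), setMinor q (opMatrix q 0 w u) I p.2 *
        setMinor q (opMatrix q 1 w w) p.2 p.1 * setMinor q (opMatrix q 2 v w) p.1 J := by
  rw [Fintype.sum_prod_type, setMinor]
  refine (IsQMatrix.listMinor_mul hq (isQMatrix_opMatrix hq 2 v w)
    (commute_mul_opMatrix hq w u v) _ J).trans (Finset.sum_congr rfl fun M _ => ?_)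
  rw [IsQMatrix.listMinor_mul hq (isQMatrix_opMatrix hq 1 w w) fun i m m' j =>
      commute_opMatrix_opMatrix hq (by decide) i m m' j, Finset.sum_mul]
  rfl

theorem setMinor_tripleMatrix_eq_zero (hq : q ≠ 0) {w u v : ℕ} {I : Finset (Fin u)}
    (hI : w < I.card) (J : Finset (Fin v)) : setMinor q (tripleMatrix q w u v) I J = 0 := by
  rw [setMinor_tripleMatrix hq]
  refine Finset.sum_eq_zero fun p _ => ?_
  rw [setMinor_eq_zero (I := I), zero_mul, zero_mul]
  exact fun h => (hI.trans_le (h.le.trans (card_finset_fin_le _))).false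

theorem strictMono_rowTop {w c : ℕ} (h : c ≤ w) : StrictMono (rowTop w c h) := fun _ _ h =>
  Nat.add_lt_add_left h _

theorem strictMono_colLeft {w c : ℕ} (h : c ≤ w) : StrictMono (colLeft w c h) := fun _ _ h => h

/-- The shift by which a product of minors of the three factors of `tripleMatrix` acts. -/
def tripleShift {c w u v : ℕ} (R : Fin c → Fin u) (L M : Fin c → Fin w) (C : Fin c → Fin v) :
    ExpLattice :=
  ∑ s, eps 0 (R s) (L s) + ∑ s, eps 1 (L s) (M s) + ∑ s, eps 2 (M s) (C s)

theorem leadForm_tripleShift_lt {c w u v : ℕ} (h : c ≤ w) (R : Fin c → Fin u) {L M : Fin c → Fin w}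
    (C : Fin c → Fin v) (hL : StrictMono L) (hM : StrictMono M)
    (hne : L ≠ rowTop w c h ∨ M ≠ colLeft w c h) :
    leadForm (w + v) (tripleShift R L M C) <
      leadForm (w + v) (tripleShift R (rowTop w c h) (colLeft w c h) C) := by
  simp only [tripleShift, map_add, map_sum, ← Finset.sum_add_distrib, leadForm_eps, labelWeight]
  have key : ∀ s, ((L s : ℤ) ≤ w - c + s ∧ (s : ℤ) ≤ M s) ∧ (C s : ℤ) + 1 ≤ v ∧
      ((rowTop w c h s : ℕ) : ℤ) = w - c + s ∧ ((colLeft w c h s : ℕ) : ℤ) = s ∧ (s : ℤ) < c := by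
    intro s
    have h1 := hL.fin_apply_le s
    have h2 := hM.le_fin_apply s
    have h3 := (C s).2
    have h4 := s.2
    have h5 : ((rowTop w c h s : ℕ) : ℤ) = w - c + s := by simp [rowTop, h]
    exact ⟨⟨by omega, by omega⟩, by omega, h5, rfl, by omega⟩
  have hle : ∀ s, ((R s : ℤ) + 1) * (L s) + (L s) * (M s) + (M s) * (C s - (w + v)) ≤
      ((R s : ℤ) + 1) * (rowTop w c h s : ℕ) + (rowTop w c h s : ℕ) * (colLeft w c h s : ℕ) +
        (colLeft w c h s : ℕ) * (C s - (w + v)) := by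
    intro s
    obtain ⟨⟨h1, h2⟩, h3, h4, h5, h6⟩ := key s
    rw [h4, h5]
    have e1 := mul_nonneg (sub_nonneg.2 h1) (by positivity : (0 : ℤ) ≤ R s + 1 + M s)
    have e2 := mul_nonneg (sub_nonneg.2 h2) (by linarith : (0 : ℤ) ≤ w + v - C s - (w - c + s))
    linarith
  have hlt : ∃ s, L s ≠ rowTop w c h s ∨ M s ≠ colLeft w c h s := by
    rcases hne with h | h
    · exact (Function.ne_iff.1 h).imp fun _ => Or.inl
    · exact (Function.ne_iff.1 h).imp fun _ => Or.inr
  obtain ⟨s, hs⟩ := hlt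
  simp only [↓reduceIte, one_ne_zero, OfNat.ofNat_ne_zero, OfNat.ofNat_ne_one]
  refine Finset.sum_lt_sum (fun s _ => hle s) ⟨s, Finset.mem_univ _, ?_⟩
  obtain ⟨⟨h1, h2⟩, h3, h4, h5, h6⟩ := key s
  have e1 := mul_nonneg (sub_nonneg.2 h1) (by positivity : (0 : ℤ) ≤ R s + 1 + M s)
  have e2 := mul_nonneg (sub_nonneg.2 h2) (by linarith : (0 : ℤ) ≤ w + v - C s - (w - c + s))
  rcases hs with hs | hs
  · have h7 : (L s : ℤ) < w - c + s := h1.lt_of_ne fun h => hs (Fin.ext (by omega))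
    have := mul_pos (sub_pos.2 h7) (by positivity : (0 : ℤ) < R s + 1 + M s)
    rw [h4, h5]
    linarith
  · have h7 : (s : ℤ) < M s := h2.lt_of_ne fun h => hs (Fin.ext (by omega))
    have := mul_pos (sub_pos.2 h7) (by linarith : (0 : ℤ) < w + v - C s - (w - c + s))
    rw [h4, h5]
    linarith

theorem Finset.exists_strictMono_image {ι : Type*} [LinearOrder ι] {I : Finset ι} {c : ℕ}
    (h : I.card = c) : ∃ R : Fin c → ι, StrictMono R ∧ Finset.univ.image R = I :=
  ⟨I.orderEmbOfFin h, (I.orderEmbOfFin h).strictMono, Finset.coe_injective (by simp)⟩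

theorem hasLead_setMinor_tripleMatrix (hq : q ≠ 0) {c w u v : ℕ} (h : c ≤ w) {R : Fin c → Fin u}
    {C : Fin c → Fin v} (hR : StrictMono R) (hC : StrictMono C) :
    HasLead (leadForm (w + v))
      (setMinor q (tripleMatrix q w u v) (Finset.univ.image R) (Finset.univ.image C))
      (tripleShift R (rowTop w c h) (colLeft w c h) C) := by
  have hlead : ∀ τ a b, ∀ {R : Fin c → Fin a} {C : Fin c → Fin b}, StrictMono R → StrictMono C →
      HasLead (leadForm (w + v))
        (setMinor q (opMatrix q τ b a) (Finset.univ.image R) (Finset.univ.image C))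
        (∑ s, eps τ (R s) (C s)) := fun τ a b R C hR hC =>
    hasLead_setMinor (ε := fun (i : Fin a) (j : Fin b) => eps τ i j) hq
      (fun i j => hasLead_opMatrix hq (leadForm_supermodular _ τ) i j)
      (fun i k j l h h' => leadForm_supermodular _ τ h h') hR hC
  have hlead' : ∀ {L M : Fin c → Fin w}, StrictMono L → StrictMono M →
      HasLead (leadForm (w + v)) (setMinor q (opMatrix q 0 w u) (Finset.univ.image R)
          (Finset.univ.image L) * setMinor q (opMatrix q 1 w w) (Finset.univ.image L)
          (Finset.univ.image M) * setMinor q (opMatrix q 2 v w) (Finset.univ.image M)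
          (Finset.univ.image C)) (tripleShift R L M C) := fun hL hM =>
    ((hlead 0 u w hR hL).mul (hlead 1 w w hL hM)).mul (hlead 2 w v hM hC)
  rw [setMinor_tripleMatrix hq]
  refine HasLead.sum (i := (Finset.univ.image (colLeft w c h), Finset.univ.image (rowTop w c h)))
    (Finset.mem_univ _) (hlead' (strictMono_rowTop h) (strictMono_colLeft h)) ?_
  rintro ⟨M, L⟩ - hne
  have hcR : (Finset.univ.image R).card = c := by
    rw [Finset.card_image_of_injective _ hR.injective, Finset.card_fin]
  have hcC : (Finset.univ.image C).card = c := by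
    rw [Finset.card_image_of_injective _ hC.injective, Finset.card_fin]
  by_cases hL : L.card = c
  · by_cases hM : M.card = c
    · obtain ⟨L, hL', rfl⟩ := Finset.exists_strictMono_image hL
      obtain ⟨M, hM', rfl⟩ := Finset.exists_strictMono_image hM
      refine (hlead' hL' hM').isLow (leadForm_tripleShift_lt h R C hL' hM' ?_)
      by_contra! h'
      exact hne (by rw [h'.1, h'.2])
    · rw [setMinor_eq_zero (I := M) _ (by rwa [hcC]), mul_zero]
      exact isLow_zero
  · rw [setMinor_eq_zero (J := L) _ (by rw [hcR]; exact fun h => hL h.symm), zero_mul, zero_mul]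
    exact isLow_zero

/-- A linear form counting the entries below `n` in position `s` of the column sets. -/
def colForm (s n : ℕ) : ExpLattice →+ ℤ := ∑ j ∈ Finset.range n, crd 2 s j

/-- A linear form counting the entries among the last `n` rows in position `s`, from the right,
of the row sets. -/
def rowForm (w u s n : ℕ) : ExpLattice →+ ℤ :=
  ∑ i : Fin u with (i.rev : ℕ) < n, crd 0 i (w - 1 - s)

theorem colForm_tripleShift {c w u v : ℕ} (h : c ≤ w) (R : Fin c → Fin u) {C : Fin c → Fin v}
    (hC : StrictMono C) (s n : ℕ) :
    colForm s n (tripleShift R (rowTop w c h) (colLeft w c h) C) =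
      if s < countBelow (Finset.univ.image C) n then 1 else 0 := by
  have h1 : ∀ τ i j, colForm s n (eps τ i j) = if τ = 2 ∧ i = s ∧ j < n then 1 else 0 := by
    intro τ i j
    have := rowPhi_eps 2 s n τ i j
    rw [rowPhi, AddMonoidHom.neg_apply, neg_eq_iff_eq_neg] at this
    rw [colForm, this]
    split_ifs <;> rfl
  simp only [lt_countBelow_image_iff hC, tripleShift, map_add, map_sum, h1]
  simp only [OfNat.zero_ne_ofNat, OfNat.one_ne_ofNat, false_and, if_false, true_and,
    Finset.sum_const_zero, zero_add]
  exact Finset.sum_fin_ite_eq s fun k => (C k : ℕ) < n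

theorem rowForm_tripleShift {c w u v : ℕ} (h : c ≤ w) {R : Fin c → Fin u} (hR : StrictMono R)
    (C : Fin c → Fin v) {s : ℕ} (hs : s < w) (n : ℕ) :
    rowForm w u s n (tripleShift R (rowTop w c h) (colLeft w c h) C) =
      if s < countBelow ((Finset.univ.image R).image Fin.rev) n then 1 else 0 := by
  have h1 : ∀ τ (i : Fin u) j, rowForm w u s n (eps τ i j) =
      if τ = 0 ∧ j = w - 1 - s ∧ (i.rev : ℕ) < n then 1 else 0 := by
    intro τ i j
    simp only [rowForm, AddMonoidHom.finsetSum_apply, crd_eps]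
    by_cases h : τ = 0 ∧ j = w - 1 - s
    · simp [h.1, h.2, Fin.val_inj, Finset.sum_ite_eq]
    · rw [if_neg fun h' => h ⟨h'.1, h'.2.1⟩]
      exact Finset.sum_eq_zero fun k _ => if_neg fun h' => h ⟨h'.1, h'.2.2⟩
  have h2 : ∀ (i j : ℕ) τ, τ ≠ 0 → rowForm w u s n (eps τ i j) = 0 := by
    intro i j τ hτ
    simp [rowForm, AddMonoidHom.finsetSum_apply, crd_eps, hτ]
  simp only [image_image_rev, lt_countBelow_image_iff hR.rev_comp_rev, tripleShift, map_add, map_sum, h1]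
  rw [Finset.sum_eq_zero fun k _ => h2 _ _ 1 one_ne_zero,
    Finset.sum_eq_zero fun k _ => h2 _ _ 2 two_ne_zero, add_zero, add_zero,
    ← Finset.sum_fin_ite_eq s fun k : Fin c => ((R k.rev).rev : ℕ) < n]
  rw [← Equiv.sum_comp Fin.revPerm]
  refine Finset.sum_congr rfl fun k _ => ?_
  have hk : ((rowTop w c h k.rev : Fin w) : ℕ) = w - 1 - s ↔ (k : ℕ) = s := by
    have := k.2
    simp only [rowTop, Fin.val_rev]
    omega
  simp [hk]

end TripleProduct

section BitableauOrder

theorem countBelow_le {v : ℕ} (J : Finset (Fin v)) (n : ℕ) : countBelow J n ≤ J.card :=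
  Finset.card_filter_le _ _

theorem countBelow_eq_card {v : ℕ} (J : Finset (Fin v)) : countBelow J v = J.card := by
  rw [countBelow, Finset.filter_true_of_mem fun x _ => x.2]

theorem countBelow_succ {v : ℕ} (J : Finset (Fin v)) (x : Fin v) :
    countBelow J (x + 1) = countBelow J x + if x ∈ J then 1 else 0 := by
  have h : J.filter (fun y : Fin v => y.1 < x + 1) =
      J.filter (fun y : Fin v => y.1 < x) ∪ J.filter (· = x) := by
    ext y
    simp only [Finset.mem_union, Finset.mem_filter, ← and_or_left, Fin.ext_iff,
      Nat.lt_succ_iff_lt_or_eq]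
  rw [countBelow, h, Finset.card_union_of_disjoint, Finset.filter_eq', countBelow]
  · split_ifs <;> simp
  · rw [Finset.disjoint_filter]
    rintro y - hy rfl
    exact hy.false

theorem countBelow_injective (v : ℕ) :
    Function.Injective (countBelow : Finset (Fin v) → ℕ → ℕ) := by
  intro J J' h
  ext x
  have h1 := countBelow_succ J x
  rw [h, countBelow_succ] at h1
  by_cases hx : x ∈ J <;> by_cases hx' : x ∈ J' <;> simp_all

theorem colLE_iff {v : ℕ} {J J' : Finset (Fin v)} :
    colLE J J' ↔ ∀ n, countBelow J' n ≤ countBelow J n := by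
  obtain ⟨C, hC, hJ⟩ := Finset.exists_strictMono_image (I := J) rfl
  obtain ⟨C', hC', hJ'⟩ := Finset.exists_strictMono_image (I := J') rfl
  have h1 : ∀ n, countBelow J' n ≤ countBelow J n ↔
      ∀ s, s < countBelow J' n → s < countBelow J n := fun n =>
    ⟨fun h s hs => hs.trans_le h, fun h => by by_contra! h'; exact (h _ h').false⟩
  simp only [h1]
  generalize J.card = c at C hC hJ
  generalize J'.card = c' at C' hC' hJ'
  subst hJ hJ'
  simp only [lt_countBelow_image_iff hC, lt_countBelow_image_iff hC', colLE,
    ← List.ofFn_eq_sort hC, ← List.ofFn_eq_sort hC', List.getElem?_ofFn,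
    Finset.card_image_of_injective _ hC.injective, Finset.card_image_of_injective _ hC'.injective,
    Finset.card_fin]
  constructor
  · rintro ⟨hc, h⟩ n s ⟨hs, hn⟩
    exact ⟨hs.trans_le hc,
      lt_of_le_of_lt (h s _ _ (by simp [hs.trans_le hc]) (by simp [hs])) hn⟩
  · intro h
    have hc : c' ≤ c := by
      by_contra! hc
      exact (h v c ⟨hc, (C' _).2⟩).1.false
    refine ⟨hc, fun s x y hx hy => ?_⟩
    split_ifs at hx hy with h1 h2
    · obtain ⟨h3, h4⟩ := h (y + 1) s ⟨h2, by simp_all⟩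
      simp only [Option.some.injEq] at hx
      rw [hx] at h4
      exact Nat.le_of_lt_succ h4

theorem rowLE_iff_colLE {u : ℕ} {I I' : Finset (Fin u)} :
    rowLE I I' ↔ colLE (I.image Fin.rev) (I'.image Fin.rev) := by
  obtain ⟨R, hR, hI⟩ := Finset.exists_strictMono_image (I := I) rfl
  obtain ⟨R', hR', hI'⟩ := Finset.exists_strictMono_image (I := I') rfl
  generalize I.card = c at R hR hI
  generalize I'.card = c' at R' hR' hI'
  subst hI hI'
  simp only [rowLE, colLE, image_image_rev, ← List.ofFn_eq_sort hR, ← List.ofFn_eq_sort hR',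
    ← List.ofFn_eq_sort hR.rev_comp_rev, ← List.ofFn_eq_sort hR'.rev_comp_rev, List.getElem?_ofFn,
    Finset.card_image_of_injective _ hR.injective, Finset.card_image_of_injective _ hR'.injective,
    Finset.card_image_of_injective _ hR.rev_comp_rev.injective,
    Finset.card_image_of_injective _ hR'.rev_comp_rev.injective, Finset.card_fin]
  refine and_congr_right fun hc => ⟨fun h s x y hx hy => ?_, fun h s x y hx hy => ?_⟩
  · split_ifs at hx hy with h1 h2
    · simp only [Option.some.injEq] at hx hy
      subst hx hy
      rw [Fin.rev_le_rev]
      refine h (c' - 1 - s) _ _ ?_ ?_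
      · rw [dif_pos (by omega)]
        congr 2
        ext
        simp only [Fin.val_rev]
        omega
      · rw [dif_pos (by omega)]
        congr 2
        ext
        simp only [Fin.val_rev]
        omega
  · split_ifs at hx hy with h1 h2
    · simp only [Option.some.injEq] at hx hy
      subst hx hy
      rw [← Fin.rev_le_rev]
      refine h (c' - 1 - s) _ _ ?_ ?_
      · rw [dif_pos (by omega)]
        congr 3
        ext
        simp only [Fin.val_rev]
        omega
      · rw [dif_pos (by omega)]
        congr 3
        ext
        simp only [Fin.val_rev]
        omega

theorem pairLE_iff {u v : ℕ} {p p' : Finset (Fin u) × Finset (Fin v)} :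
    pairLE p p' ↔
      (∀ n, countBelow (p'.1.image Fin.rev) n ≤ countBelow (p.1.image Fin.rev) n) ∧
        ∀ n, countBelow p'.2 n ≤ countBelow p.2 n := by
  rw [pairLE, rowLE_iff_colLE, colLE_iff, colLE_iff]

theorem IsPreferredBT.pairwise {u v : ℕ} {L : List (Finset (Fin u) × Finset (Fin v))}
    (h : IsPreferredBT L) : L.Pairwise pairLE := by
  have : IsTrans (Finset (Fin u) × Finset (Fin v)) pairLE := ⟨fun a b c hab hbc => by
    rw [pairLE_iff] at *
    exact ⟨fun n => (hbc.1 n).trans (hab.1 n), fun n => (hbc.2 n).trans (hab.2 n)⟩⟩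
  exact List.isChain_iff_pairwise.1 h.2

theorem List.eq_of_sum_lt_countBelow_eq {v : ℕ} {L L' : List (Finset (Fin v))}
    (hL : L.Pairwise fun J J' => ∀ n, countBelow J' n ≤ countBelow J n)
    (hL' : L'.Pairwise fun J J' => ∀ n, countBelow J' n ≤ countBelow J n)
    (h0 : ∀ J ∈ L, 0 < J.card) (h0' : ∀ J ∈ L', 0 < J.card)
    (h : ∀ s n, (L.map fun J => if s < countBelow J n then (1 : ℤ) else 0).sum =
      (L'.map fun J => if s < countBelow J n then (1 : ℤ) else 0).sum) : L = L' := by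
  have hnonneg : ∀ (L : List (Finset (Fin v))) (s n : ℕ),
      0 ≤ (L.map fun J => if s < countBelow J n then (1 : ℤ) else 0).sum := by
    refine fun L s n => List.sum_nonneg fun x hx => ?_
    obtain ⟨J, -, rfl⟩ := List.mem_map.1 hx
    positivity
  have hhead : ∀ (J : Finset (Fin v)) (L : List (Finset (Fin v))),
      ((J :: L).Pairwise fun J J' => ∀ n, countBelow J' n ≤ countBelow J n) → ∀ s n,
      0 < ((J :: L).map fun J => if s < countBelow J n then (1 : ℤ) else 0).sum ↔
        s < countBelow J n := by
    intro J L hJ s n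
    rw [List.map_cons, List.sum_cons]
    split_ifs with hs
    · have := hnonneg L s n
      simp only [hs, iff_true]
      omega
    · rw [List.sum_eq_zero]
      · simp [hs]
      · intro x hx
        obtain ⟨J', hJ', rfl⟩ := List.mem_map.1 hx
        have := (List.pairwise_cons.1 hJ).1 J' hJ' n
        exact if_neg fun h => hs (h.trans_le this)
  have hcard : ∀ J : Finset (Fin v), 0 < J.card → 0 < countBelow J v := fun J h => by
    rwa [countBelow_eq_card]
  induction L generalizing L' with
  | nil =>
    cases L' with
    | nil => rfl
    | cons J' L' =>
      have := (hhead J' L' hL' 0 v).2 (hcard _ (h0' J' (by simp)))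
      rw [← h] at this
      simp at this
  | cons J L ih =>
    cases L' with
    | nil =>
      have := (hhead J L hL 0 v).2 (hcard _ (h0 J (by simp)))
      rw [h] at this
      simp at this
    | cons J' L' =>
      obtain rfl : J = J' := countBelow_injective v <| funext fun n => by
        have h1 : ∀ s, s < countBelow J n ↔ s < countBelow J' n := fun s => by
          rw [← hhead J L hL, h, hhead J' L' hL']
        exact le_antisymm (not_lt.1 fun h => ((h1 _).1 h).false)
          (not_lt.1 fun h => ((h1 _).2 h).false)
      rw [ih hL.of_cons hL'.of_cons (fun K hK => h0 K (by simp [hK]))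
        (fun K hK => h0' K (by simp [hK])) fun s n => by simpa using h s n]

theorem List.eq_of_map_fst_snd_eq {α β : Type*} {L L' : List (α × β)}
    (h1 : L.map Prod.fst = L'.map Prod.fst) (h2 : L.map Prod.snd = L'.map Prod.snd) : L = L' := by
  rw [← List.zip_unzip L, ← List.zip_unzip L', List.unzip_fst, List.unzip_snd, List.unzip_fst,
    List.unzip_snd, h1, h2]

/-- A preferred bitableau with rows of length at most `w` is determined by its profiles. -/
theorem IsPreferredBT.ext {w u v : ℕ} {L L' : List (Finset (Fin u) × Finset (Fin v))}
    (hL : IsPreferredBT L) (hL' : IsPreferredBT L') (hw : ∀ p ∈ L, p.1.card ≤ w)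
    (hw' : ∀ p ∈ L', p.1.card ≤ w)
    (hr : ∀ s < w, ∀ n,
      (L.map fun p => if s < countBelow (p.1.image Fin.rev) n then (1 : ℤ) else 0).sum =
        (L'.map fun p => if s < countBelow (p.1.image Fin.rev) n then (1 : ℤ) else 0).sum)
    (hc : ∀ s n, (L.map fun p => if s < countBelow p.2 n then (1 : ℤ) else 0).sum =
      (L'.map fun p => if s < countBelow p.2 n then (1 : ℤ) else 0).sum) : L = L' := by
  have hrev : ∀ I : Finset (Fin u), (I.image Fin.rev).card = I.card := fun I =>
    Finset.card_image_of_injective _ Fin.rev_injective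
  refine List.eq_of_map_fst_snd_eq
    ((List.map_injective_iff.2 (Finset.image_injective Fin.rev_injective)) ?_) ?_
  · refine List.eq_of_sum_lt_countBelow_eq ?_ ?_ ?_ ?_ fun s n => ?_
    · simp only [List.pairwise_map]
      exact hL.pairwise.imp fun h => (pairLE_iff.1 h).1
    · simp only [List.pairwise_map]
      exact hL'.pairwise.imp fun h => (pairLE_iff.1 h).1
    · simp only [List.map_map, List.mem_map]
      rintro _ ⟨p, hp, rfl⟩
      exact (hL.1 p hp).2.trans_eq (hrev _).symm
    · simp only [List.map_map, List.mem_map]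
      rintro _ ⟨p, hp, rfl⟩
      exact (hL'.1 p hp).2.trans_eq (hrev _).symm
    · by_cases hs : s < w
      · simpa [List.map_map, Function.comp_def] using hr s hs n
      · have hzero : ∀ L : List (Finset (Fin u) × Finset (Fin v)), (∀ p ∈ L, p.1.card ≤ w) →
            (((L.map Prod.fst).map (Finset.image Fin.rev)).map
              fun J => if s < countBelow J n then (1 : ℤ) else 0).sum = 0 := by
          intro L hL
          refine List.sum_eq_zero fun x hx => ?_
          simp only [List.map_map, List.mem_map] at hx
          obtain ⟨p, hp, rfl⟩ := hx
          refine if_neg fun h => hs (h.trans_le ((countBelow_le _ _).trans ?_))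
          exact (hrev _).trans_le (hL p hp)
        rw [hzero L hw, hzero L' hw']
  · refine List.eq_of_sum_lt_countBelow_eq ?_ ?_ ?_ ?_ fun s n => ?_
    · simp only [List.pairwise_map]
      exact hL.pairwise.imp fun h => (pairLE_iff.1 h).2
    · simp only [List.pairwise_map]
      exact hL'.pairwise.imp fun h => (pairLE_iff.1 h).2
    · simp only [List.mem_map]
      rintro _ ⟨p, hp, rfl⟩
      exact (hL.1 p hp).2.trans_eq (hL.1 p hp).1
    · simp only [List.mem_map]
      rintro _ ⟨p, hp, rfl⟩
      exact (hL'.1 p hp).2.trans_eq (hL'.1 p hp).1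
    · simpa [List.map_map, Function.comp_def] using hc s n

end BitableauOrder

section Independence

variable {K : Type*} [Field K] {q : K}

theorem exists_hasLead_setMinor_tripleMatrix (hq : q ≠ 0) {w u v : ℕ} {I : Finset (Fin u)}
    {J : Finset (Fin v)} (hIJ : I.card = J.card) (hw : I.card ≤ w) :
    ∃ a : ExpLattice, HasLead (leadForm (w + v)) (setMinor q (tripleMatrix q w u v) I J) a ∧
      (∀ s < w, ∀ n, rowForm w u s n a = if s < countBelow (I.image Fin.rev) n then 1 else 0) ∧
      ∀ s n, colForm s n a = if s < countBelow J n then 1 else 0 := by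
  obtain ⟨R, hR, hI⟩ := Finset.exists_strictMono_image (I := I) rfl
  obtain ⟨C, hC, hJ⟩ := Finset.exists_strictMono_image hIJ.symm
  generalize I.card = c at *
  subst hI hJ
  exact ⟨_, hasLead_setMinor_tripleMatrix hq hw hR hC,
    fun s hs n => rowForm_tripleShift hw hR C hs n, fun s n => colForm_tripleShift hw R hC s n⟩

theorem linearIndependent_prod_setMinor_tripleMatrix (hq : q ≠ 0) (w u v : ℕ) :
    LinearIndependent K fun L : {L : List (Finset (Fin u) × Finset (Fin v)) //
      IsPreferredBT L ∧ ∀ p ∈ L, p.1.card ≤ w} =>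
        (L.1.map fun p => setMinor q (tripleMatrix q w u v) p.1 p.2).prod := by
  choose! a ha hr hc using fun (p : Finset (Fin u) × Finset (Fin v)) (hp : p.1.card = p.2.card)
    (hw : p.1.card ≤ w) => exists_hasLead_setMinor_tripleMatrix hq hp hw
  refine linearIndependent_of_hasLead (F := leadForm (w + v)) (a := fun L => (L.1.map a).sum)
    (fun L L' h => Subtype.ext ?_) fun L => ?_
  · have hr' : ∀ L : {L : List (Finset (Fin u) × Finset (Fin v)) //
        IsPreferredBT L ∧ ∀ p ∈ L, p.1.card ≤ w}, ∀ s < w, ∀ n,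
        rowForm w u s n (L.1.map a).sum = (L.1.map fun p =>
          if s < countBelow (p.1.image Fin.rev) n then (1 : ℤ) else 0).sum := by
      intro L s hs n
      rw [map_list_sum, List.map_map]
      exact congrArg List.sum
        (List.map_congr_left fun p hp => hr p (L.2.1.1 p hp).1 (L.2.2 p hp) s hs n)
    have hc' : ∀ L : {L : List (Finset (Fin u) × Finset (Fin v)) //
        IsPreferredBT L ∧ ∀ p ∈ L, p.1.card ≤ w}, ∀ s n,
        colForm s n (L.1.map a).sum =
          (L.1.map fun p => if s < countBelow p.2 n then (1 : ℤ) else 0).sum := by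
      intro L s n
      rw [map_list_sum, List.map_map]
      exact congrArg List.sum
        (List.map_congr_left fun p hp => hc p (L.2.1.1 p hp).1 (L.2.2 p hp) s n)
    refine L.2.1.ext L'.2.1 L.2.2 L'.2.2 (fun s hs n => ?_) fun s n => ?_
    · rw [← hr' L s hs, ← hr' L' s hs]
      exact congrArg _ h
    · rw [← hc', ← hc']
      exact congrArg _ h
  · exact HasLead.list_prod fun p hp => ha p (L.2.1.1 p hp).1 (L.2.2 p hp)

end Independence

section Growth

/-- The local rule of growth diagrams: the partition completing a square with corners `κ`, `l`,
`m` and entry `a`. -/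
def growthStep (κ l m : ℕ → ℕ) (a : ℕ) : ℕ → ℕ
  | 0 => max (l 0) (m 0) + a
  | s + 1 => max (l (s + 1)) (m (s + 1)) + min (l s) (m s) - κ s

/-- The growth diagram of a matrix of natural numbers. -/
def growth (A : ℕ → ℕ → ℕ) : ℕ → ℕ → ℕ → ℕ
  | 0, _ => 0
  | _ + 1, 0 => 0
  | i + 1, j + 1 => growthStep (growth A i j) (growth A i (j + 1)) (growth A (i + 1) j) (A i j)

/-- The partition `l` is obtained from `κ` by adding a horizontal strip. -/
def Interlaces (κ l : ℕ → ℕ) : Prop := ∀ s, κ s ≤ l s ∧ l (s + 1) ≤ κ s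

theorem interlaces_growthStep {κ l m : ℕ → ℕ} (hl : Interlaces κ l) (hm : Interlaces κ m) (a : ℕ) :
    Interlaces l (growthStep κ l m a) ∧ Interlaces m (growthStep κ l m a) := by
  constructor <;> refine fun s => ⟨?_, ?_⟩
  · cases s with
    | zero => exact (le_max_left _ _).trans (Nat.le_add_right _ _)
    | succ s =>
      have := hl s
      have := hm s
      simp only [growthStep]
      omega
  · have := hl s
    have := hm s
    simp only [growthStep]
    omega
  · cases s with
    | zero => exact (le_max_right _ _).trans (Nat.le_add_right _ _)
    | succ s =>
      have := hl s
      have := hm s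
      simp only [growthStep]
      omega
  · have := hl s
    have := hm s
    simp only [growthStep]
    omega

variable (A : ℕ → ℕ → ℕ)

theorem growth_zero_left (j : ℕ) : growth A 0 j = 0 := by rw [growth]

theorem growth_zero_right (i : ℕ) : growth A i 0 = 0 := by cases i <;> rw [growth]

theorem growth_succ_succ (i j : ℕ) : growth A (i + 1) (j + 1) =
    growthStep (growth A i j) (growth A i (j + 1)) (growth A (i + 1) j) (A i j) := by rw [growth]

theorem interlaces_growth_left {i : ℕ} (h : ∀ j, Interlaces (growth A i j) (growth A i (j + 1)))
    (j : ℕ) : Interlaces (growth A i j) (growth A (i + 1) j) := by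
  induction j with
  | zero =>
    simp only [growth_zero_right]
    exact fun s => ⟨le_rfl, le_rfl⟩
  | succ j ih =>
    rw [growth_succ_succ]
    exact (interlaces_growthStep (h j) ih _).1

theorem interlaces_growth_right (i j : ℕ) : Interlaces (growth A i j) (growth A i (j + 1)) := by
  induction i generalizing j with
  | zero =>
    simp only [growth_zero_left]
    exact fun s => ⟨le_rfl, le_rfl⟩
  | succ i ih =>
    rw [growth_succ_succ]
    exact (interlaces_growthStep (ih j) (interlaces_growth_left A ih j) _).2

theorem growth_antitone (i j : ℕ) : Antitone (growth A i j) := by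
  refine antitone_nat_of_succ_le fun s => ?_
  have := interlaces_growth_right A i j s
  have h := interlaces_growth_right A i j (s + 1)
  exact h.1.trans this.2

theorem growth_eq_zero {i j s : ℕ} (h : i ≤ s) : growth A i j s = 0 := by
  induction i generalizing j s with
  | zero => rw [growth_zero_left, Pi.zero_apply]
  | succ i ih =>
    obtain ⟨s, rfl⟩ : ∃ r, s = r + 1 := ⟨s - 1, by omega⟩
    have := interlaces_growth_left A (interlaces_growth_right A i) j s
    rw [ih (by omega)] at this
    exact Nat.le_zero.1 this.2

theorem growth_monotone_left (j s : ℕ) : Monotone fun i => growth A i j s :=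
  monotone_nat_of_le_succ fun i => (interlaces_growth_left A (interlaces_growth_right A i) j s).1

theorem growth_monotone_right (i s : ℕ) : Monotone fun j => growth A i j s :=
  monotone_nat_of_le_succ fun j => (interlaces_growth_right A i j s).1

theorem sum_growthStep {κ l m : ℕ → ℕ} (hl : Interlaces κ l) (hm : Interlaces κ m) (a : ℕ) {N : ℕ}
    (hN : l N = 0) : ∑ s ∈ Finset.range (N + 1), growthStep κ l m a s +
      ∑ s ∈ Finset.range (N + 1), κ s =
        ∑ s ∈ Finset.range (N + 1), l s + ∑ s ∈ Finset.range (N + 1), m s + a := by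
  have h1 : ∑ s ∈ Finset.range N, growthStep κ l m a (s + 1) + ∑ s ∈ Finset.range N, κ s =
      ∑ s ∈ Finset.range N, max (l (s + 1)) (m (s + 1)) + ∑ s ∈ Finset.range N, min (l s) (m s) := by
    rw [← Finset.sum_add_distrib, ← Finset.sum_add_distrib]
    refine Finset.sum_congr rfl fun s _ => ?_
    have := hl s
    have := hm s
    simp only [growthStep]
    omega
  have h2 : ∑ s ∈ Finset.range (N + 1), max (l s) (m s) +
      ∑ s ∈ Finset.range (N + 1), min (l s) (m s) =
        ∑ s ∈ Finset.range (N + 1), l s + ∑ s ∈ Finset.range (N + 1), m s := by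
    rw [← Finset.sum_add_distrib, ← Finset.sum_add_distrib]
    exact Finset.sum_congr rfl fun s _ => max_add_min _ _
  have h3 := (hl N).1
  rw [Finset.sum_range_succ', Finset.sum_range_succ κ]
  rw [Finset.sum_range_succ' (fun s => max (l s) (m s)),
    Finset.sum_range_succ (fun s => min (l s) (m s))] at h2
  simp only [growthStep] at h1 ⊢
  omega

theorem sum_growth {N i : ℕ} (h : i ≤ N) (j : ℕ) : ∑ s ∈ Finset.range (N + 1), growth A i j s =
    ∑ a ∈ Finset.range i, ∑ b ∈ Finset.range j, A a b := by
  induction i generalizing j with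
  | zero => simp [growth_zero_left]
  | succ i ih =>
    induction j with
    | zero => simp [growth_zero_right]
    | succ j ihj =>
      have h1 := sum_growthStep (interlaces_growth_right A i j)
        (interlaces_growth_left A (interlaces_growth_right A i) j) (A i j) (N := N)
        (growth_eq_zero A (by omega))
      rw [← growth_succ_succ, ih (by omega), ih (by omega), ihj] at h1
      simp only [Finset.sum_range_succ _ i, Finset.sum_range_succ _ j,
        Finset.sum_add_distrib] at h1 ⊢
      omega

theorem growthStep_injective {κ l m κ' : ℕ → ℕ} {a a' : ℕ} (hl : Interlaces κ l)
    (hm : Interlaces κ m) (hl' : Interlaces κ' l) (hm' : Interlaces κ' m)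
    (h : growthStep κ l m a = growthStep κ' l m a') : κ = κ' ∧ a = a' := by
  refine ⟨funext fun s => ?_, ?_⟩
  · have h1 := congrFun h (s + 1)
    have := hl s
    have := hm s
    have := hl' s
    have := hm' s
    simp only [growthStep] at h1
    omega
  · have h1 := congrFun h 0
    simp only [growthStep] at h1
    omega

variable {A}

/-- A matrix is determined by the boundary of its growth diagram. -/
theorem eq_of_growth_eq {A' : ℕ → ℕ → ℕ} {u v : ℕ} (hu : ∀ j ≤ v, growth A u j = growth A' u j)
    (hv : ∀ i ≤ u, growth A i v = growth A' i v) {i j : ℕ} (hi : i < u) (hj : j < v) :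
    A i j = A' i j := by
  have step : ∀ i j, growth A (i + 1) (j + 1) = growth A' (i + 1) (j + 1) →
      growth A i (j + 1) = growth A' i (j + 1) → growth A (i + 1) j = growth A' (i + 1) j →
      growth A i j = growth A' i j ∧ A i j = A' i j := by
    intro i j h1 h2 h3
    rw [growth_succ_succ, growth_succ_succ, ← h2, ← h3] at h1
    refine growthStep_injective (interlaces_growth_right A i j)
      (interlaces_growth_left A (interlaces_growth_right A i) j) ?_ ?_ h1
    · rw [h2]
      exact interlaces_growth_right A' i j
    · rw [h3]
      exact interlaces_growth_left A' (interlaces_growth_right A' i) j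
  have key : ∀ i ≤ u, ∀ j ≤ v, growth A i j = growth A' i j := by
    intro i hi
    induction hi using Nat.decreasingInduction with
    | self => exact hu
    | of_succ i hi ih =>
      intro j hj
      induction hj using Nat.decreasingInduction with
      | self => exact hv i hi.le
      | of_succ j hj ihj => exact (step i j (ih _ hj) ihj (ih _ hj.le)).1
  exact (step i j (key _ hi _ hj) (key _ hi.le _ hj) (key _ hi _ hj.le)).2

/-- The conjugate partition of `l`, for `l` vanishing from `N` on. -/
def conjPart (N : ℕ) (l : ℕ → ℕ) (k : ℕ) : ℕ := ((Finset.range N).filter fun s => k < l s).card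

theorem lt_conjPart_iff {N : ℕ} {l : ℕ → ℕ} (hl : Antitone l) (hN : l N = 0) {k s : ℕ} :
    s < conjPart N l k ↔ k < l s := by
  constructor
  · intro h
    by_contra! hk
    refine h.not_ge (le_of_le_of_eq (Finset.card_le_card (t := Finset.range s) fun a ha => ?_)
      (Finset.card_range s))
    rw [Finset.mem_range]
    by_contra! hsa
    exact ((Finset.mem_filter.1 ha).2.trans_le ((hl hsa).trans hk)).false
  · intro h
    refine lt_of_lt_of_le (lt_of_lt_of_eq s.lt_succ_self (Finset.card_range _).symm)
      (Finset.card_le_card fun a ha => ?_)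
    have hk : k < l a := h.trans_le (hl (Nat.le_of_lt_succ (Finset.mem_range.1 ha)))
    refine Finset.mem_filter.2 ⟨Finset.mem_range.2 ?_, hk⟩
    by_contra! hNa
    have := hl hNa
    omega

theorem Interlaces.conjPart_le {N : ℕ} {κ l : ℕ → ℕ} (h : Interlaces κ l) (hκ : Antitone κ)
    (hl : Antitone l) (hκN : κ N = 0) (hlN : l N = 0) (k : ℕ) :
    conjPart N κ k ≤ conjPart N l k ∧ conjPart N l k ≤ conjPart N κ k + 1 := by
  constructor <;> by_contra! hlt
  · rw [lt_conjPart_iff hκ hκN] at hlt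
    exact ((lt_conjPart_iff hl hlN).2 (hlt.trans_le (h _).1)).false
  · rw [lt_conjPart_iff hl hlN] at hlt
    exact ((lt_conjPart_iff hκ hκN).2 (hlt.trans_le (h _).2)).false

theorem conjPart_antitone (N : ℕ) (l : ℕ → ℕ) : Antitone (conjPart N l) := fun _ _ h =>
  Finset.card_le_card (Finset.monotone_filter_right _ fun _ _ hx => h.trans_lt hx)

theorem sum_conjPart {N M : ℕ} {l : ℕ → ℕ} (hM : ∀ s, l s ≤ M) :
    ∑ k ∈ Finset.range M, conjPart N l k = ∑ s ∈ Finset.range N, l s := by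
  simp only [conjPart, Finset.card_filter]
  rw [Finset.sum_comm]
  refine Finset.sum_congr rfl fun s _ => ?_
  have h : (Finset.range M).filter (fun k => k < l s) = Finset.range (l s) := by
    ext k
    have := hM s
    simp only [Finset.mem_filter, Finset.mem_range]
    omega
  rw [← Finset.card_filter, h, Finset.card_range]

/-- The set of jumps of `c` below `v`. -/
def jumpSet (v : ℕ) (c : ℕ → ℕ) : Finset (Fin v) :=
  Finset.univ.filter fun j : Fin v => c j < c (j + 1)

theorem countBelow_jumpSet {v : ℕ} {c : ℕ → ℕ} (h0 : c 0 = 0)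
    (hc : ∀ n, c n ≤ c (n + 1) ∧ c (n + 1) ≤ c n + 1) {n : ℕ} (hn : n ≤ v) :
    countBelow (jumpSet v c) n = c n := by
  induction n with
  | zero => simp [countBelow, h0]
  | succ n ih =>
    have h1 := countBelow_succ (jumpSet v c) ⟨n, hn⟩
    rw [ih (by omega)] at h1
    rw [h1]
    have := hc n
    simp only [jumpSet, Finset.mem_filter, Finset.mem_univ, true_and]
    split_ifs <;> omega

theorem countBelow_min {v : ℕ} (J : Finset (Fin v)) (n : ℕ) :
    countBelow J (min n v) = countBelow J n := by
  simp only [countBelow]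
  congr 1
  ext x
  simp only [Finset.mem_filter, lt_min_iff, x.2, and_true]

end Growth

section GrowthBitableau

/-- The bitableau read off from the boundary of a growth diagram. -/
def growthBitableau (u v : ℕ) (A : ℕ → ℕ → ℕ) : List (Finset (Fin u) × Finset (Fin v)) :=
  (List.range (growth A u v 0)).map fun k =>
    ((jumpSet u fun i => conjPart u (growth A i v) k).image Fin.rev,
      jumpSet v fun j => conjPart u (growth A u j) k)

variable {u v : ℕ} (A : ℕ → ℕ → ℕ)

theorem conjPart_zero (N k : ℕ) : conjPart N 0 k = 0 := by simp [conjPart]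

theorem countBelow_jumpSet_col {j : ℕ} (hj : j ≤ v) (k : ℕ) :
    countBelow (jumpSet v fun j => conjPart u (growth A u j) k) j = conjPart u (growth A u j) k :=
  countBelow_jumpSet (by rw [growth_zero_right, conjPart_zero])
    (fun j => (interlaces_growth_right A u j).conjPart_le (growth_antitone A u j)
      (growth_antitone A u (j + 1)) (growth_eq_zero A le_rfl) (growth_eq_zero A le_rfl) k) hj

theorem countBelow_jumpSet_row {i : ℕ} (hi : i ≤ u) (k : ℕ) :
    countBelow (jumpSet u fun i => conjPart u (growth A i v) k) i =
      conjPart u (growth A i v) k := by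
  have h : countBelow (jumpSet u fun i => conjPart u (growth A (min i u) v) k) i =
      conjPart u (growth A (min i u) v) k := by
    refine countBelow_jumpSet (by rw [Nat.zero_min, growth_zero_left, conjPart_zero])
      (fun i => ?_) hi
    rcases lt_or_ge i u with h | h
    · rw [min_eq_left h.le, min_eq_left h]
      exact (interlaces_growth_left A (interlaces_growth_right A i) v).conjPart_le
        (growth_antitone A i v) (growth_antitone A (i + 1) v) (growth_eq_zero A h.le)
        (growth_eq_zero A h) k
    · rw [min_eq_right h, min_eq_right (h.trans i.le_succ)]
      exact ⟨le_rfl, Nat.le_succ _⟩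
  rw [min_eq_left hi] at h
  rw [← h]
  congr 1
  ext x
  have h1 : min (x : ℕ) u = x := min_eq_left x.2.le
  have h2 : min ((x : ℕ) + 1) u = x + 1 := min_eq_left x.2
  simp only [jumpSet, Finset.mem_filter, h1, h2]

theorem image_rev_image_rev (I : Finset (Fin u)) : (I.image Fin.rev).image Fin.rev = I := by
  rw [Finset.image_image, Fin.rev_involutive.comp_self, Finset.image_id]

theorem card_image_rev (I : Finset (Fin u)) : (I.image Fin.rev).card = I.card :=
  Finset.card_image_of_injective _ Fin.rev_injective

theorem card_growthBitableau_snd (k : ℕ) :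
    (jumpSet v fun j => conjPart u (growth A u j) k).card = conjPart u (growth A u v) k := by
  rw [← countBelow_eq_card, countBelow_jumpSet_col A le_rfl]

theorem card_growthBitableau_fst (k : ℕ) :
    ((jumpSet u fun i => conjPart u (growth A i v) k).image Fin.rev).card =
      conjPart u (growth A u v) k := by
  rw [card_image_rev, ← countBelow_eq_card, countBelow_jumpSet_row A le_rfl]

theorem isPreferredBT_growthBitableau : IsPreferredBT (growthBitableau u v A) := by
  constructor
  · intro p hp
    obtain ⟨k, hk, rfl⟩ := List.mem_map.1 hp
    rw [card_growthBitableau_fst, card_growthBitableau_snd]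
    exact ⟨rfl, (lt_conjPart_iff (growth_antitone A u v) (growth_eq_zero A le_rfl)).2
      (List.mem_range.1 hk)⟩
  · refine List.Pairwise.isChain ?_
    rw [growthBitableau, List.pairwise_map]
    refine List.pairwise_lt_range.imp fun h => pairLE_iff.2 ⟨fun n => ?_, fun n => ?_⟩
    · rw [image_rev_image_rev, image_rev_image_rev, ← countBelow_min, ← countBelow_min _ n,
        countBelow_jumpSet_row A (min_le_right n u), countBelow_jumpSet_row A (min_le_right n u)]
      exact conjPart_antitone _ _ h.le
    · rw [← countBelow_min, ← countBelow_min _ n,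
        countBelow_jumpSet_col A (min_le_right n v), countBelow_jumpSet_col A (min_le_right n v)]
      exact conjPart_antitone _ _ h.le

theorem sum_card_growthBitableau : ((growthBitableau u v A).map fun p => p.1.card).sum =
    ∑ i ∈ Finset.range u, ∑ j ∈ Finset.range v, A i j := by
  rw [← sum_growth A le_rfl, Finset.sum_range_succ, growth_eq_zero A le_rfl, add_zero,
    ← sum_conjPart fun s => growth_antitone A u v s.zero_le]
  simp only [growthBitableau, List.map_map, Function.comp_def, card_growthBitableau_fst]
  rfl

theorem List.countP_range_lt {m n : ℕ} (h : m ≤ n) : (List.range n).countP (· < m) = m := by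
  obtain ⟨k, rfl⟩ := Nat.exists_eq_add_of_le h
  rw [List.range_add, List.countP_append, List.countP_eq_length.2, List.countP_eq_zero.2] <;> simp

theorem countP_growthBitableau_snd {j : ℕ} (hj : j ≤ v) (s : ℕ) :
    (growthBitableau u v A).countP (fun p => s < countBelow p.2 j) = growth A u j s := by
  simp only [growthBitableau, List.countP_map, Function.comp_def, countBelow_jumpSet_col A hj,
    lt_conjPart_iff (growth_antitone A u _) (growth_eq_zero A le_rfl)]
  exact List.countP_range_lt ((growth_monotone_right A u s hj).trans
    (growth_antitone A u v s.zero_le))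

theorem countP_growthBitableau_fst {i : ℕ} (hi : i ≤ u) (s : ℕ) :
    (growthBitableau u v A).countP (fun p => s < countBelow (p.1.image Fin.rev) i) =
      growth A i v s := by
  simp only [growthBitableau, List.countP_map, Function.comp_def, image_rev_image_rev,
    countBelow_jumpSet_row A hi,
    lt_conjPart_iff (growth_antitone A i _) (growth_eq_zero A hi)]
  exact List.countP_range_lt ((growth_monotone_left A v s hi).trans
    (growth_antitone A u v s.zero_le))

variable {A}

theorem eq_of_growthBitableau_eq {A' : ℕ → ℕ → ℕ}
    (h : growthBitableau u v A = growthBitableau u v A') {i j : ℕ} (hi : i < u) (hj : j < v) :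
    A i j = A' i j := by
  refine eq_of_growth_eq (fun j hj => funext fun s => ?_) (fun i hi => funext fun s => ?_) hi hj
  · rw [← countP_growthBitableau_snd A hj, ← countP_growthBitableau_snd A' hj, h]
  · rw [← countP_growthBitableau_fst A hi, ← countP_growthBitableau_fst A' hi, h]

/-- The matrix of multiplicities of a multiset of positions. -/
def countMatrix (s : Multiset (Fin u × Fin v)) (i j : ℕ) : ℕ :=
  if h : i < u ∧ j < v then s.count (⟨i, h.1⟩, ⟨j, h.2⟩) else 0

theorem growthBitableau_countMatrix_injective :
    Function.Injective fun s : Multiset (Fin u × Fin v) => growthBitableau u v (countMatrix s) := by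
  refine fun s s' h => Multiset.ext.2 fun p => ?_
  have := eq_of_growthBitableau_eq h p.1.2 p.2.2
  simpa [countMatrix] using this

theorem sum_countMatrix (s : Multiset (Fin u × Fin v)) :
    ∑ i ∈ Finset.range u, ∑ j ∈ Finset.range v, countMatrix s i j = s.card := by
  simp only [Finset.sum_range, countMatrix, Fin.is_lt, and_self, dif_pos, Fin.eta]
  rw [← Fintype.sum_prod_type fun p : Fin u × Fin v => s.count p]
  exact Multiset.sum_count_eq_card fun _ _ => Finset.mem_univ _

end GrowthBitableau

section Spanning

variable {K : Type} [Field K] {q : K} {u v : ℕ}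

/-- The position of an index pair in the row-by-row enumeration. -/
def rowMajor (p : Fin u × Fin v) : ℕ := p.1 * v + p.2

theorem rowMajor_lt_of_fst_lt {p p' : Fin u × Fin v} (h : p.1 < p'.1) :
    rowMajor p < rowMajor p' := by
  have h1 : ((p.1 : ℕ) + 1) * v ≤ p'.1 * v := Nat.mul_le_mul_right v h
  have := p.2.2
  rw [rowMajor, rowMajor]
  linarith

theorem rowMajor_injective : Function.Injective (rowMajor : Fin u × Fin v → ℕ) := by
  intro p p' h
  rcases lt_trichotomy p.1 p'.1 with h' | h' | h'
  · exact absurd h (rowMajor_lt_of_fst_lt h').ne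
  · exact Prod.ext h' (Fin.ext (by simpa [rowMajor, h'] using h))
  · exact absurd h (rowMajor_lt_of_fst_lt h').ne'

variable (K q)

/-- The product of the generators at a list of positions. -/
def word (l : List (Fin u × Fin v)) : OqM K q u v := (l.map fun p => Xg K q p.1 p.2).prod

variable {K q}

theorem word_append (l l' : List (Fin u × Fin v)) :
    word K q (l ++ l') = word K q l * word K q l' := by
  simp [word]

theorem word_cons (p : Fin u × Fin v) (l : List (Fin u × Fin v)) :
    word K q (p :: l) = Xg K q p.1 p.2 * word K q l := by
  simp [word]

theorem word_pair_mem_span (hq : q ≠ 0) {p p' : Fin u × Fin v} (h : rowMajor p' < rowMajor p) :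
    Xg K q p.1 p.2 * Xg K q p'.1 p'.2 ∈ Submodule.span K {x | ∃ a b : Fin u × Fin v,
      rowMajor a < rowMajor p ∧ rowMajor a + rowMajor b = rowMajor p + rowMajor p' ∧
        x = Xg K q a.1 a.2 * Xg K q b.1 b.2} := by
  have hX := isQMatrix_Xg K q u v
  have hmem : Xg K q p'.1 p'.2 * Xg K q p.1 p.2 ∈ Submodule.span K {x | ∃ a b : Fin u × Fin v,
      rowMajor a < rowMajor p ∧ rowMajor a + rowMajor b = rowMajor p + rowMajor p' ∧
        x = Xg K q a.1 a.2 * Xg K q b.1 b.2} :=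
    Submodule.subset_span ⟨p', p, h, add_comm _ _, rfl⟩
  rcases lt_trichotomy p'.1 p.1 with hi | hi | hi
  · rcases lt_trichotomy p'.2 p.2 with hj | hj | hj
    · rw [← sub_eq_iff_eq_add.2 (hX.quantum hi hj)]
      refine Submodule.sub_mem _ hmem (Submodule.smul_mem _ _ (Submodule.subset_span
        ⟨(p'.1, p.2), (p.1, p'.2), rowMajor_lt_of_fst_lt hi, ?_, rfl⟩))
      simp only [rowMajor]
      omega
    · have := hX.col (j := p.2) hi
      rw [hj, this] at hmem
      rw [hj]
      exact (Submodule.smul_mem_iff _ hq).1 hmem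
    · rwa [← hX.comm hi hj]
  · have hj : p'.2 < p.2 := by
      simp only [rowMajor, hi] at h
      omega
    have := hX.row (i := p.1) hj
    rw [hi, this] at hmem
    rw [hi]
    exact (Submodule.smul_mem_iff _ hq).1 hmem
  · exact absurd h (rowMajor_lt_of_fst_lt hi).not_gt

/-- A weight of words that decreases under straightening. -/
def wordWeight : List (Fin u × Fin v) → ℕ
  | [] => 0
  | p :: l => (l.length + 1) * rowMajor p + wordWeight l

theorem wordWeight_append_lt (l : List (Fin u × Fin v)) {r r' : List (Fin u × Fin v)}
    (h : r.length = r'.length) (hw : wordWeight r < wordWeight r') :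
    wordWeight (l ++ r) < wordWeight (l ++ r') := by
  induction l with
  | nil => exact hw
  | cons p l ih => simpa [wordWeight, h] using ih

theorem word_mem_span_sorted (hq : q ≠ 0) (l : List (Fin u × Fin v)) :
    word K q l ∈ Submodule.span K {x | ∃ l' : List (Fin u × Fin v), l'.length = l.length ∧
      l'.Pairwise (fun p p' => rowMajor p ≤ rowMajor p') ∧ x = word K q l'} := by
  by_cases hl : l.IsChain fun p p' => rowMajor p ≤ rowMajor p'
  · have : IsTrans (Fin u × Fin v) fun p p' => rowMajor p ≤ rowMajor p' :=
      ⟨fun _ _ _ h h' => h.trans h'⟩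
    exact Submodule.subset_span ⟨l, rfl, List.isChain_iff_pairwise.1 hl, rfl⟩
  · rw [List.isChain_iff_forall_rel_of_append_cons_cons] at hl
    push Not at hl
    obtain ⟨a, b, l₁, l₂, rfl, hab⟩ := hl
    set S := Submodule.span K {x | ∃ l' : List (Fin u × Fin v),
      l'.length = (l₁ ++ a :: b :: l₂).length ∧
      l'.Pairwise (fun p p' => rowMajor p ≤ rowMajor p') ∧ x = word K q l'} with hS
    suffices h : Submodule.span K {x | ∃ a' b' : Fin u × Fin v,
        rowMajor a' < rowMajor a ∧ rowMajor a' + rowMajor b' = rowMajor a + rowMajor b ∧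
          x = Xg K q a'.1 a'.2 * Xg K q b'.1 b'.2} ≤
        S.comap (LinearMap.mulLeft K (word K q l₁) ∘ₗ LinearMap.mulRight K (word K q l₂)) by
      simpa [word_append, word_cons, mul_assoc] using h (word_pair_mem_span hq hab)
    rw [Submodule.span_le]
    rintro _ ⟨a', b', h1, h2, rfl⟩
    have hlen : (l₁ ++ a' :: b' :: l₂).length = (l₁ ++ a :: b :: l₂).length := by simp
    have hlt : wordWeight (l₁ ++ a' :: b' :: l₂) < wordWeight (l₁ ++ a :: b :: l₂) := by
      refine wordWeight_append_lt l₁ (by simp) ?_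
      simp only [wordWeight, List.length_cons]
      nlinarith
    have := word_mem_span_sorted hq (l₁ ++ a' :: b' :: l₂)
    rw [hlen, ← hS] at this
    simpa only [SetLike.mem_coe, Submodule.mem_comap, LinearMap.comp_apply,
      LinearMap.mulLeft_apply, LinearMap.mulRight_apply, word_append, word_cons, mul_assoc]
      using this
termination_by wordWeight l

variable (K q u v)

/-- The span of the generators of `O_q(M_{u,v})`. -/
def genSpan : Submodule K (OqM K q u v) :=
  Submodule.span K (Set.range fun p : Fin u × Fin v => Xg K q p.1 p.2)

theorem genSpan_pow_le_span_word (d : ℕ) : genSpan K q u v ^ d ≤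
    Submodule.span K {x | ∃ l : List (Fin u × Fin v), l.length = d ∧ x = word K q l} := by
  induction d with
  | zero =>
    rw [pow_zero, Submodule.one_le]
    exact Submodule.subset_span ⟨[], rfl, rfl⟩
  | succ d ih =>
    rw [pow_succ]
    refine (mul_le_mul' ih le_rfl).trans ?_
    rw [genSpan, Submodule.span_mul_span, Submodule.span_le]
    rintro _ ⟨_, ⟨l, rfl, rfl⟩, _, ⟨p, rfl⟩, rfl⟩
    exact Submodule.subset_span ⟨l ++ [p], by simp, by simp [word]⟩

variable {K q u v}

theorem exists_genSpan_pow_le_span_range (hq : q ≠ 0) (d : ℕ) :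
    ∃ g : Sym (Fin u × Fin v) d → OqM K q u v,
      genSpan K q u v ^ d ≤ Submodule.span K (Set.range g) := by
  have hinj : ∀ l l' : List (Fin u × Fin v), l.Pairwise (fun p p' => rowMajor p ≤ rowMajor p') →
      l'.Pairwise (fun p p' => rowMajor p ≤ rowMajor p') →
      (l : Multiset (Fin u × Fin v)) = l' → l = l' := fun l l' hl hl' h =>
    (Multiset.coe_eq_coe.1 h).eq_of_pairwise
      (fun _ _ _ _ h h' => rowMajor_injective (le_antisymm h h')) hl hl'
  classical
  refine ⟨fun s => if h : ∃ l : List (Fin u × Fin v),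
      l.Pairwise (fun p p' => rowMajor p ≤ rowMajor p') ∧ (l : Multiset (Fin u × Fin v)) = s then
    word K q h.choose else 0, (genSpan_pow_le_span_word K q u v d).trans ?_⟩
  rw [Submodule.span_le]
  rintro _ ⟨l, rfl, rfl⟩
  refine Submodule.span_mono ?_ (word_mem_span_sorted hq l)
  rintro _ ⟨l', hlen, hl', rfl⟩
  have h : ∃ l : List (Fin u × Fin v), l.Pairwise (fun p p' => rowMajor p ≤ rowMajor p') ∧
    (l : Multiset (Fin u × Fin v)) = l' := ⟨l', hl', rfl⟩
  exact ⟨⟨l', (Multiset.coe_card l').trans hlen⟩,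
    (dif_pos h).trans (congrArg (word K q) (hinj _ _ h.choose_spec.1 hl' h.choose_spec.2))⟩

theorem Xg_mem_genSpan (i : Fin u) (j : Fin v) : Xg K q i j ∈ genSpan K q u v :=
  Submodule.subset_span ⟨(i, j), rfl⟩

theorem listMinor_mem_genSpan_pow (is : List (Fin u)) (J : Finset (Fin v)) :
    listMinor q (Xg K q) is J ∈ genSpan K q u v ^ is.length := by
  induction is generalizing J with
  | nil =>
    rw [listMinor]
    split_ifs
    · exact Submodule.one_le.1 (pow_zero _).ge
    · exact Submodule.zero_mem _
  | cons i is ih =>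
    rw [listMinor_cons, List.length_cons, pow_succ']
    exact Submodule.sum_mem _ fun j _ => Submodule.smul_mem _ _
      (Submodule.mul_mem_mul (Xg_mem_genSpan i j) (ih _))

theorem btProd_mem_genSpan_pow (L : List (Finset (Fin u) × Finset (Fin v))) :
    btProd K q L ∈ genSpan K q u v ^ (L.map fun p => p.1.card).sum := by
  induction L with
  | nil => exact Submodule.one_le.1 (pow_zero _).ge
  | cons p L ih =>
    have h := listMinor_mem_genSpan_pow (K := K) (q := q) (p.1.sort (· ≤ ·)) p.2
    rw [Finset.length_sort] at h
    simp only [btProd, List.map_cons, List.prod_cons, List.sum_cons] at ih ⊢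
    rw [pow_add, qMinorF_eq_setMinor]
    exact Submodule.mul_mem_mul h ih

theorem iSup_genSpan_pow : ⨆ d, genSpan K q u v ^ d = ⊤ := by
  have hle : ∀ d, genSpan K q u v ^ d ≤ ⨆ d, genSpan K q u v ^ d := le_iSup _
  rw [eq_top_iff]
  rintro a -
  induction a using OqM.induction with
  | algebraMap c => exact hle 0 (by rw [pow_zero]; exact Submodule.algebraMap_mem c)
  | X i j => exact hle 1 (by rw [pow_one]; exact Xg_mem_genSpan i j)
  | mul a b ha hb =>
    have := Submodule.mul_mem_mul ha hb
    rw [Submodule.iSup_mul] at this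
    simp only [Submodule.mul_iSup, ← pow_add] at this
    exact (iSup_le fun i => iSup_le fun j => hle (i + j)) this
  | add a b ha hb => exact Submodule.add_mem _ ha hb

theorem btProd_eq_prod_setMinor (L : List (Finset (Fin u) × Finset (Fin v))) :
    btProd K q L = (L.map fun p => setMinor q (Xg K q) p.1 p.2).prod := by
  simp only [btProd, qMinorF_eq_setMinor]

theorem OqM.lift_btProd {B : Type} [Ring B] [Algebra K B] {x : Fin u → Fin v → B}
    (hx : IsQMatrix q x) (L : List (Finset (Fin u) × Finset (Fin v))) :
    OqM.lift x hx (btProd K q L) = (L.map fun p => setMinor q x p.1 p.2).prod := by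
  rw [btProd_eq_prod_setMinor, map_list_prod, List.map_map]
  refine congrArg List.prod (List.map_congr_left fun p _ =>
    (map_setMinor (OqM.lift x hx) (Xg K q) p.1 p.2).trans ?_)
  simp only [OqM.lift_Xg]

theorem linearIndependent_btProd (hq : q ≠ 0) (u v : ℕ) :
    LinearIndependent K fun L : {L : List (Finset (Fin u) × Finset (Fin v)) // IsPreferredBT L} =>
      btProd K q L.1 := by
  have h := (linearIndependent_prod_setMinor_tripleMatrix hq u u v).comp
    (fun L : {L : List (Finset (Fin u) × Finset (Fin v)) // IsPreferredBT L} =>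
      ⟨L.1, L.2, fun p _ => card_finset_fin_le _⟩) fun L L' h => by simpa [Subtype.ext_iff] using h
  refine LinearIndependent.of_comp
    (OqM.lift (tripleMatrix q u u v) (isQMatrix_tripleMatrix hq u u v)).toLinearMap ?_
  have hfun : (⇑(OqM.lift (tripleMatrix q u u v) (isQMatrix_tripleMatrix hq u u v)).toLinearMap ∘
      fun L : {L : List (Finset (Fin u) × Finset (Fin v)) // IsPreferredBT L} => btProd K q L.1) =
      fun L => (L.1.map fun p => setMinor q (tripleMatrix q u u v) p.1 p.2).prod :=
    funext fun L => OqM.lift_btProd _ L.1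
  rw [hfun]
  exact h

theorem span_btProd (hq : q ≠ 0) (u v : ℕ) :
    Submodule.span K (Set.range fun L : {L : List (Finset (Fin u) × Finset (Fin v)) //
      IsPreferredBT L} => btProd K q L.1) = ⊤ := by
  rw [eq_top_iff, ← iSup_genSpan_pow]
  refine iSup_le fun d => ?_
  obtain ⟨g, hg⟩ := exists_genSpan_pow_le_span_range (K := K) (u := u) (v := v) hq d
  have hfin : FiniteDimensional K (Submodule.span K (Set.range g)) :=
    FiniteDimensional.span_of_finite K (Set.finite_range g)
  have hfin' : FiniteDimensional K ↥(genSpan K q u v ^ d) :=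
    Submodule.finiteDimensional_of_le hg
  let φ : Sym (Fin u × Fin v) d → {L : List (Finset (Fin u) × Finset (Fin v)) //
      IsPreferredBT L} := fun s =>
    ⟨growthBitableau u v (countMatrix s.1), isPreferredBT_growthBitableau _⟩
  have hφ : Function.Injective φ := fun s s' h =>
    Subtype.ext (growthBitableau_countMatrix_injective (Subtype.ext_iff.1 h))
  have hli := (linearIndependent_btProd (K := K) hq u v).comp φ hφ
  have hle : Submodule.span K (Set.range ((fun L : {L : List (Finset (Fin u) × Finset (Fin v)) //
      IsPreferredBT L} => btProd K q L.1) ∘ φ)) ≤ genSpan K q u v ^ d := by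
    rw [Submodule.span_le]
    rintro _ ⟨s, rfl⟩
    have := btProd_mem_genSpan_pow (K := K) (q := q) (φ s).1
    rwa [sum_card_growthBitableau, sum_countMatrix, s.2] at this
  have heq := Submodule.eq_of_le_of_finrank_le hle (by
    rw [finrank_span_eq_card hli]
    exact (Submodule.finrank_mono hg).trans (finrank_range_le_card g))
  rw [← heq]
  exact Submodule.span_mono (Set.range_comp_subset_range _ _)

end Spanning

theorem LinearIndependent.tmul_subtype {K M N α β : Type*} [Field K] [AddCommGroup M] [Module K M]
    [AddCommGroup N] [Module K N] {P : α → Prop} {Q : β → Prop} {f : α → M} {g : β → N}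
    (hf : LinearIndependent K fun a : {a // P a} => f a.1)
    (hg : LinearIndependent K fun b : {b // Q b} => g b.1) :
    LinearIndependent K fun x : {x : α × β // P x.1 ∧ Q x.2} => f x.1.1 ⊗ₜ[K] g x.1.2 :=
  (hf.tmul_of_isDomain hg).comp
    (fun x : {x : α × β // P x.1 ∧ Q x.2} => (⟨x.1.1, x.2.1⟩, ⟨x.1.2, x.2.2⟩)) fun x y h => by
      rw [Prod.mk.injEq, Subtype.mk.injEq, Subtype.mk.injEq] at h
      exact Subtype.ext (Prod.ext h.1 h.2)

section NormalElements

variable {K R : Type} [Field K] [Ring R] [Algebra K R]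

theorem tsSpan_singleton_of_normal {d : R} (hd : ∀ a, ∃ b, a * d = d * b) :
    tsSpan K R {d} = (LinearMap.mulLeft K d).range := by
  refine congrArg SetLike.coe (le_antisymm (Submodule.span_le.2 ?_) ?_)
  · rintro _ ⟨a, b, _, rfl, rfl⟩
    obtain ⟨c, hc⟩ := hd a
    exact ⟨c * b, by rw [LinearMap.mulLeft_apply, hc, mul_assoc]⟩
  · rintro _ ⟨a, rfl⟩
    exact Submodule.subset_span ⟨1, a, d, rfl, by rw [one_mul, LinearMap.mulLeft_apply]⟩

theorem normal_map {R' : Type} [Ring R'] [Algebra K R'] (f : R →ₐ[K] R')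
    (hf : Function.Surjective f) {d : R} (hd : ∀ a, ∃ b, a * d = d * b) (a : R') :
    ∃ b, a * f d = f d * b := by
  obtain ⟨a, rfl⟩ := hf a
  obtain ⟨b, hb⟩ := hd a
  exact ⟨f b, by rw [← map_mul, hb, map_mul]⟩

theorem normal_tmul {R' : Type} [Ring R'] [Algebra K R'] {d : R} {d' : R'}
    (hd : ∀ a, ∃ b, a * d = d * b) (hd' : ∀ a, ∃ b, a * d' = d' * b) (a : R ⊗[K] R') :
    ∃ b, a * d ⊗ₜ[K] d' = d ⊗ₜ[K] d' * b := by
  induction a using TensorProduct.induction_on with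
  | zero => exact ⟨0, by rw [zero_mul, mul_zero]⟩
  | tmul a a' =>
    obtain ⟨b, hb⟩ := hd a
    obtain ⟨b', hb'⟩ := hd' a'
    exact ⟨b ⊗ₜ b', by simp only [Algebra.TensorProduct.tmul_mul_tmul, hb, hb']⟩
  | add a a' h h' =>
    obtain ⟨b, hb⟩ := h
    obtain ⟨b', hb'⟩ := h'
    exact ⟨b + b', by rw [add_mul, mul_add, hb, hb']⟩

theorem range_mulLeft_tmul {R' : Type} [Ring R'] [Algebra K R'] (d : R) (d' : R') :
    (LinearMap.mulLeft K (d ⊗ₜ[K] d')).range =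
      Submodule.map₂ (TensorProduct.mk K R R') (LinearMap.mulLeft K d).range
        (LinearMap.mulLeft K d').range := by
  refine le_antisymm ?_ (Submodule.map₂_le.2 ?_)
  · rintro _ ⟨a, rfl⟩
    induction a using TensorProduct.induction_on with
    | zero => rw [map_zero]; exact Submodule.zero_mem _
    | tmul a a' =>
      rw [LinearMap.mulLeft_apply, Algebra.TensorProduct.tmul_mul_tmul]
      exact Submodule.apply_mem_map₂ _ ⟨a, rfl⟩ ⟨a', rfl⟩
    | add a a' h h' => rw [map_add]; exact Submodule.add_mem _ h h'
  · rintro _ ⟨a, rfl⟩ _ ⟨a', rfl⟩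
    exact ⟨a ⊗ₜ a', Algebra.TensorProduct.tmul_mul_tmul _ _ _ _⟩

variable {q : K}

theorem normal_qMinorF (hq : q ≠ 0) {u v : ℕ} {I : Finset (Fin u)} {J : Finset (Fin v)}
    (hIJ : I.card = J.card) (hI : ∀ i ∉ I, ∀ k ∈ I, i < k) (hJ : ∀ l ∉ J, ∀ j ∈ J, j < l)
    (a : OqM K q u v) : ∃ b, a * qMinorF K q I J = qMinorF K q I J * b := by
  rw [qMinorF_eq_setMinor]
  induction a using OqM.induction with
  | algebraMap r => exact ⟨algebraMap K _ r, Algebra.commutes _ _⟩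
  | X i j =>
    obtain ⟨c, -, hc⟩ := (isQMatrix_Xg K q u v).exists_mul_setMinor_eq_smul hq hIJ hI hJ i j
    exact ⟨c • Xg K q i j, by rw [hc, mul_smul_comm]⟩
  | mul a a' h h' =>
    obtain ⟨b, hb⟩ := h
    obtain ⟨b', hb'⟩ := h'
    exact ⟨b * b', by rw [mul_assoc, hb', ← mul_assoc, hb, mul_assoc]⟩
  | add a a' h h' =>
    obtain ⟨b, hb⟩ := h
    obtain ⟨b', hb'⟩ := h'
    exact ⟨b + b', by rw [add_mul, mul_add, hb, hb']⟩

end NormalElements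

section ExtremalIndexSets

variable {n t : ℕ} (h : t ≤ n)

theorem mem_Jtilde {x : Fin n} : x ∈ Jtilde n t h ↔ (x : ℕ) < t := by
  simp only [Jtilde, Finset.mem_image, Finset.mem_univ, true_and]
  exact ⟨by rintro ⟨i, rfl⟩; exact i.2, fun hx => ⟨⟨x, hx⟩, rfl⟩⟩

theorem card_Jtilde : (Jtilde n t h).card = t := by
  rw [Jtilde, Finset.card_image_of_injective _ (strictMono_colLeft h).injective, Finset.card_fin]

theorem card_Itilde : (Itilde n t h).card = t := by
  rw [Itilde, Finset.card_image_of_injective _ (strictMono_rowTop h).injective, Finset.card_fin]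

theorem mem_Itilde {x : Fin n} : x ∈ Itilde n t h ↔ n - t ≤ (x : ℕ) := by
  simp only [Itilde, Finset.mem_image, Finset.mem_univ, true_and]
  refine ⟨by rintro ⟨i, rfl⟩; exact Nat.le_add_right _ _, fun hx => ?_⟩
  have := x.2
  exact ⟨⟨x - (n - t), by omega⟩, Fin.ext (Nat.add_sub_cancel' hx)⟩

theorem image_rev_Itilde : (Itilde n t h).image Fin.rev = Jtilde n t h := by
  ext x
  simp only [Finset.mem_image, mem_Itilde, mem_Jtilde]
  have := x.2
  constructor
  · rintro ⟨y, hy, rfl⟩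
    have := y.2
    rw [Fin.val_rev]
    omega
  · exact fun hx => ⟨x.rev, by rw [Fin.val_rev]; omega, Fin.rev_rev x⟩

theorem Itilde_self (t : ℕ) : Itilde t t le_rfl = Finset.univ :=
  Finset.eq_univ_of_card _ (by rw [card_Itilde, Fintype.card_fin])

theorem Jtilde_self (t : ℕ) : Jtilde t t le_rfl = Finset.univ :=
  Finset.eq_univ_of_card _ (by rw [card_Jtilde, Fintype.card_fin])

theorem colLE_Jtilde {J : Finset (Fin n)} (hJ : J.card ≤ t) : colLE (Jtilde n t h) J := by
  rw [colLE_iff]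
  intro m
  rcases le_total m t with hm | hm
  · refine Finset.card_le_card fun x hx => ?_
    rw [Finset.mem_filter] at hx ⊢
    exact ⟨(mem_Jtilde h).2 (hx.2.trans_le hm), hx.2⟩
  · refine (countBelow_le J m).trans (hJ.trans ?_)
    rw [countBelow, Finset.filter_true_of_mem fun x hx => ((mem_Jtilde h).1 hx).trans_le hm,
      card_Jtilde]

theorem rowLE_Itilde {I : Finset (Fin n)} (hI : I.card ≤ t) : rowLE (Itilde n t h) I := by
  rw [rowLE_iff_colLE, image_rev_Itilde]
  exact colLE_Jtilde h (by rwa [card_image_rev])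

theorem lt_of_notMem_Itilde : ∀ i ∉ Itilde n t h, ∀ k ∈ Itilde n t h, i < k := by
  intro i hi k hk
  rw [mem_Itilde] at hi hk
  exact Fin.lt_def.2 (by omega)

theorem lt_of_notMem_Jtilde : ∀ l ∉ Jtilde n t h, ∀ j ∈ Jtilde n t h, j < l := by
  intro l hl j hj
  rw [mem_Jtilde] at hl hj
  exact Fin.lt_def.2 (by omega)

end ExtremalIndexSets

section FirstRow

variable {K : Type} [Field K] {q : K} {u v : ℕ}

theorem IsPreferredBT.cons {L : List (Finset (Fin u) × Finset (Fin v))} (hL : IsPreferredBT L)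
    {p : Finset (Fin u) × Finset (Fin v)} (hp : p.1.card = p.2.card ∧ 0 < p.1.card)
    (h : ∀ p' ∈ L, pairLE p p') : IsPreferredBT (p :: L) :=
  ⟨List.forall_mem_cons.2 ⟨hp, hL.1⟩,
    List.isChain_cons.2 ⟨fun p' hp' => h p' (List.mem_of_mem_head? hp'), hL.2⟩⟩

theorem IsPreferredBT.card_le_of_head? {L : List (Finset (Fin u) × Finset (Fin v))}
    (hL : IsPreferredBT L) {p : Finset (Fin u) × Finset (Fin v)} (hp : L.head? = some p) :
    ∀ p' ∈ L, p'.1.card ≤ p.1.card := by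
  obtain ⟨L, rfl⟩ : ∃ L', L = p :: L' := ⟨L.tail, (List.cons_head?_tail hp).symm⟩
  rintro p' (_ | ⟨_, hp'⟩)
  · exact le_rfl
  · exact ((List.pairwise_cons.1 hL.pairwise).1 p' hp').1.1

theorem btProd_cons (p : Finset (Fin u) × Finset (Fin v))
    (L : List (Finset (Fin u) × Finset (Fin v))) :
    btProd K q (p :: L) = qMinorF K q p.1 p.2 * btProd K q L := by
  simp only [btProd, List.map_cons, List.prod_cons]

theorem span_btProd_head? (hq : q ≠ 0) {B : Type} [Ring B] [Algebra K B]
    (f : OqM K q u v →ₐ[K] B) (hf : Function.Surjective f)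
    {p : Finset (Fin u) × Finset (Fin v)} (hp : p.1.card = p.2.card ∧ 0 < p.1.card)
    (hmin : ∀ L, IsPreferredBT L → f (btProd K q L) ≠ 0 → ∀ p' ∈ L, pairLE p p') :
    Submodule.span K (Set.range
      fun L : {L : List (Finset (Fin u) × Finset (Fin v)) //
        IsPreferredBT L ∧ L.head? = some p} => f (btProd K q L.1)) =
      (LinearMap.mulLeft K (f (qMinorF K q p.1 p.2))).range := by
  refine le_antisymm (Submodule.span_le.2 ?_) ?_
  · rintro _ ⟨⟨L, hL, hLp⟩, rfl⟩
    obtain ⟨L, rfl⟩ : ∃ L', L = p :: L' := ⟨L.tail, (List.cons_head?_tail hLp).symm⟩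
    exact ⟨f (btProd K q L), ((congrArg f (btProd_cons p L)).trans (map_mul f _ _)).symm⟩
  · rintro _ ⟨a, rfl⟩
    obtain ⟨a, rfl⟩ := hf a
    have ha : a ∈ Submodule.span K (Set.range fun L : {L : List (Finset (Fin u) × Finset (Fin v)) //
      IsPreferredBT L} => btProd K q L.1) := by rw [span_btProd hq]; exact Submodule.mem_top
    induction ha using Submodule.span_induction with
    | mem a ha =>
      obtain ⟨⟨L, hL⟩, rfl⟩ := ha
      by_cases h0 : f (btProd K q L) = 0
      · simp only [h0, map_zero, Submodule.zero_mem]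
      · exact Submodule.subset_span ⟨⟨p :: L, hL.cons hp (hmin L hL h0), rfl⟩,
          (congrArg f (btProd_cons p L)).trans (map_mul f _ _)⟩
    | zero => simp only [map_zero, Submodule.zero_mem]
    | add a b _ _ ha hb => rw [map_add, map_add]; exact Submodule.add_mem _ ha hb
    | smul c a _ ha => rw [map_smul, map_smul]; exact Submodule.smul_mem _ c ha

theorem linearIndependent_mkle_btProd (hq : q ≠ 0) (u v t : ℕ) :
    LinearIndependent K fun L : {L : List (Finset (Fin u) × Finset (Fin v)) //
      IsPreferredBT L ∧ ∀ p ∈ L, p.1.card ≤ t} => mkle K q u v t (btProd K q L.1) := by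
  obtain ⟨f, hf⟩ := OqMle.exists_lift (t := t) (tripleMatrix q t u v)
    (isQMatrix_tripleMatrix hq t u v) fun I J hI =>
      setMinor_tripleMatrix_eq_zero hq (by rw [hI]; exact Nat.lt_succ_self t) J
  refine LinearIndependent.of_comp f.toLinearMap ?_
  have hfun : (⇑f.toLinearMap ∘ fun L : {L : List (Finset (Fin u) × Finset (Fin v)) //
      IsPreferredBT L ∧ ∀ p ∈ L, p.1.card ≤ t} => mkle K q u v t (btProd K q L.1)) =
      fun L => (L.1.map fun p => setMinor q (tripleMatrix q t u v) p.1 p.2).prod :=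
    funext fun L => (hf _).trans (OqM.lift_btProd _ L.1)
  rw [hfun]
  exact linearIndependent_prod_setMinor_tripleMatrix hq t u v

theorem mkle_btProd_eq_zero {t : ℕ} {L : List (Finset (Fin u) × Finset (Fin v))}
    {p : Finset (Fin u) × Finset (Fin v)} (hp : p ∈ L) (h : t < p.1.card) :
    mkle K q u v t (btProd K q L) = 0 := by
  induction L with
  | nil => simp at hp
  | cons p' L ih =>
    refine (congrArg _ (btProd_cons p' L)).trans ((map_mul (mkle K q u v t) _ _).trans ?_)
    rcases List.mem_cons.1 hp with rfl | hp
    · rw [qMinorF_eq_setMinor, mkle_setMinor_eq_zero K q h, zero_mul]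
    · rw [ih hp, mul_zero]

theorem mkle_surjective (K : Type) [Field K] (q : K) (m n t : ℕ) :
    Function.Surjective (mkle K q m n t) :=
  RingQuot.mkAlgHom_surjective K _

theorem btProd_head?_basis (hq : q ≠ 0) {p : Finset (Fin u) × Finset (Fin v)}
    (hp : p.1.card = p.2.card ∧ 0 < p.1.card) (hmin : ∀ p', p'.1.card = p'.2.card → pairLE p p') :
    LinearIndependent K (fun L : {L : List (Finset (Fin u) × Finset (Fin v)) //
        IsPreferredBT L ∧ L.head? = some p} => btProd K q L.1) ∧
      Submodule.span K (Set.range fun L : {L : List (Finset (Fin u) × Finset (Fin v)) //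
        IsPreferredBT L ∧ L.head? = some p} => btProd K q L.1) =
      (LinearMap.mulLeft K (qMinorF K q p.1 p.2)).range := by
  refine ⟨?_, ?_⟩
  · exact (linearIndependent_btProd (K := K) hq u v).comp
      (fun L : {L : List (Finset (Fin u) × Finset (Fin v)) //
        IsPreferredBT L ∧ L.head? = some p} => ⟨L.1, L.2.1⟩)
      fun L L' h => Subtype.ext (Subtype.mk.inj h)
  · have := span_btProd_head? hq (AlgHom.id K (OqM K q u v)) Function.surjective_id hp
      fun L hL _ p' hp' => hmin p' (hL.1 p' hp').1
    simpa only [AlgHom.id_apply] using this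

end FirstRow

/-- (case `m = n > t`) preferred-basis description of the ideals `⟨d_Y⟩`,
`⟨d_Z⟩`, `⟨d_Y ⊗ d_Z⟩` and `⟨d_x⟩`:
(a) the `[T|T']` with `(T,T')` preferred with first row `(Ĩ,J̃)` form a `K`-basis of
    `⟨d_Y⟩ ⊲ O_q(M_{n,t})`;
(b) the `[T|T']` with `(T,T')` preferred with first row `(J̃,J̃)` form a `K`-basis of
    `⟨d_Z⟩ ⊲ O_q(M_{t,n})`;
(c) the pure tensors `[S|S'] ⊗ [T|T']`, with `(S,S')`, `(T,T')` preferred with first rows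
    `(Ĩ,J̃)` and `(J̃,J̃)`, form a `K`-basis of `⟨d_Y ⊗ d_Z⟩ ⊲ O_q(V)`;
(d) the cosets of the `[T|T']` with `(T,T')` preferred with first row `(Ĩ,J̃)` form a
    `K`-basis of `⟨d_x⟩ ⊲ O_q(M_n^{≤t})`. -/
theorem stmt11 (K : Type) [Field K] (q : K) (hq : q ≠ 0) (n t : ℕ) (ht : 0 < t)
    (htn : t < n) :
    -- (a)
    (LinearIndependent K
        (fun L : {L : List (Finset (Fin n) × Finset (Fin t)) //
            IsPreferredBT L ∧ L.head? = some (Itilde n t htn.le, Finset.univ)} =>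
          btProd K q L.1) ∧
      (Submodule.span K (Set.range
          (fun L : {L : List (Finset (Fin n) × Finset (Fin t)) //
              IsPreferredBT L ∧ L.head? = some (Itilde n t htn.le, Finset.univ)} =>
            btProd K q L.1)) : Set (OqM K q n t)) =
        tsSpan K (OqM K q n t) {dY K q n t htn.le}) ∧
    -- (b)
    (LinearIndependent K
        (fun L : {L : List (Finset (Fin t) × Finset (Fin n)) //
            IsPreferredBT L ∧ L.head? = some (Finset.univ, Jtilde n t htn.le)} =>
          btProd K q L.1) ∧
      (Submodule.span K (Set.range
          (fun L : {L : List (Finset (Fin t) × Finset (Fin n)) //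
              IsPreferredBT L ∧ L.head? = some (Finset.univ, Jtilde n t htn.le)} =>
            btProd K q L.1)) : Set (OqM K q t n)) =
        tsSpan K (OqM K q t n) {dZ K q n t htn.le}) ∧
    -- (c)
    (LinearIndependent K
        (fun P : {P : List (Finset (Fin n) × Finset (Fin t)) ×
              List (Finset (Fin t) × Finset (Fin n)) //
            (IsPreferredBT P.1 ∧ P.1.head? = some (Itilde n t htn.le, Finset.univ)) ∧
            (IsPreferredBT P.2 ∧ P.2.head? = some (Finset.univ, Jtilde n t htn.le))} =>
          btProd K q P.1.1 ⊗ₜ[K] btProd K q P.1.2) ∧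
      (Submodule.span K (Set.range
          (fun P : {P : List (Finset (Fin n) × Finset (Fin t)) ×
                List (Finset (Fin t) × Finset (Fin n)) //
              (IsPreferredBT P.1 ∧ P.1.head? = some (Itilde n t htn.le, Finset.univ)) ∧
              (IsPreferredBT P.2 ∧ P.2.head? = some (Finset.univ, Jtilde n t htn.le))} =>
            btProd K q P.1.1 ⊗ₜ[K] btProd K q P.1.2)) :
          Set (OqM K q n t ⊗[K] OqM K q t n)) =
        tsSpan K (OqM K q n t ⊗[K] OqM K q t n)
          {dY K q n t htn.le ⊗ₜ[K] dZ K q n t htn.le}) ∧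
    -- (d)
    (LinearIndependent K
        (fun L : {L : List (Finset (Fin n) × Finset (Fin n)) //
            IsPreferredBT L ∧ L.head? = some (Itilde n t htn.le, Jtilde n t htn.le)} =>
          mkle K q n n t (btProd K q L.1)) ∧
      (Submodule.span K (Set.range
          (fun L : {L : List (Finset (Fin n) × Finset (Fin n)) //
              IsPreferredBT L ∧ L.head? = some (Itilde n t htn.le, Jtilde n t htn.le)} =>
            mkle K q n n t (btProd K q L.1))) : Set (OqMle K q n n t)) =
        tsSpan K (OqMle K q n n t) {dx K q n t htn.le}) := by
  have hY : dY K q n t htn.le = qMinorF K q (Itilde n t htn.le) Finset.univ := by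
    rw [qMinorF_eq_setMinor, dY, qMinor_eq_setMinor K q (strictMono_rowTop _) strictMono_id,
      Finset.image_id, Itilde]
  have hZ : dZ K q n t htn.le = qMinorF K q Finset.univ (Jtilde n t htn.le) := by
    rw [qMinorF_eq_setMinor, dZ, qMinor_eq_setMinor K q strictMono_id (strictMono_colLeft _),
      Finset.image_id, Jtilde]
  have hX : dX K q n t htn.le = qMinorF K q (Itilde n t htn.le) (Jtilde n t htn.le) := by
    rw [qMinorF_eq_setMinor, dX,
      qMinor_eq_setMinor K q (strictMono_rowTop _) (strictMono_colLeft _), Itilde, Jtilde]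
  have hcI := card_Itilde htn.le
  have hcJ := card_Jtilde htn.le
  have hcU : (Finset.univ : Finset (Fin t)).card = t := Finset.card_fin t
  have hnY := normal_qMinorF (K := K) hq (hcI.trans hcU.symm) (lt_of_notMem_Itilde htn.le)
    fun l hl => absurd (Finset.mem_univ l) hl
  have hnZ := normal_qMinorF (K := K) hq (hcU.trans hcJ.symm)
    (fun i hi => absurd (Finset.mem_univ i) hi) (lt_of_notMem_Jtilde htn.le)
  have hnX := normal_qMinorF (K := K) hq (hcI.trans hcJ.symm) (lt_of_notMem_Itilde htn.le)
    (lt_of_notMem_Jtilde htn.le)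
  obtain ⟨hYi, hYs⟩ := btProd_head?_basis (K := K) hq
    (p := (Itilde n t htn.le, (Finset.univ : Finset (Fin t))))
    ⟨hcI.trans hcU.symm, ht.trans_eq hcI.symm⟩ fun p' hp' =>
      have hle : p'.2.card ≤ t := card_finset_fin_le _
      ⟨rowLE_Itilde htn.le (hp'.trans_le hle), Jtilde_self t ▸ colLE_Jtilde le_rfl hle⟩
  obtain ⟨hZi, hZs⟩ := btProd_head?_basis (K := K) hq
    (p := ((Finset.univ : Finset (Fin t)), Jtilde n t htn.le))
    ⟨hcU.trans hcJ.symm, ht.trans_eq hcU.symm⟩ fun p' hp' =>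
      have hle : p'.1.card ≤ t := card_finset_fin_le _
      ⟨Itilde_self t ▸ rowLE_Itilde le_rfl hle, colLE_Jtilde htn.le (hp'.symm.trans_le hle)⟩
  refine ⟨⟨hYi, ?_⟩, ⟨hZi, ?_⟩, ⟨?_, ?_⟩, ?_, ?_⟩
  · rw [hY, tsSpan_singleton_of_normal hnY, hYs]
  · rw [hZ, tsSpan_singleton_of_normal hnZ, hZs]
  · exact hYi.tmul_subtype hZi
  · rw [hY, hZ, tsSpan_singleton_of_normal (normal_tmul hnY hnZ), range_mulLeft_tmul, ← hYs,
      ← hZs, Submodule.map₂_span_span]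
    congr 2
    ext x
    constructor
    · rintro ⟨P, rfl⟩
      exact ⟨_, ⟨⟨P.1.1, P.2.1⟩, rfl⟩, _, ⟨⟨P.1.2, P.2.2⟩, rfl⟩, rfl⟩
    · rintro ⟨_, ⟨L, rfl⟩, _, ⟨L', rfl⟩, rfl⟩
      exact ⟨⟨(L.1, L'.1), L.2, L'.2⟩, rfl⟩
  · exact (linearIndependent_mkle_btProd (K := K) hq n n t).comp
      (fun L : {L : List (Finset (Fin n) × Finset (Fin n)) //
          IsPreferredBT L ∧ L.head? = some (Itilde n t htn.le, Jtilde n t htn.le)} =>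
        ⟨L.1, L.2.1, fun p hp => (L.2.1.card_le_of_head? L.2.2 p hp).trans_eq hcI⟩)
      fun L L' h => Subtype.ext (Subtype.mk.inj h)
  · have hs := mkle_surjective K q n n t
    rw [dx, hX, tsSpan_singleton_of_normal (normal_map _ hs hnX)]
    refine congrArg SetLike.coe (span_btProd_head? hq (B := OqMle K q n n t) _ hs
      ⟨hcI.trans hcJ.symm, ht.trans_eq hcI.symm⟩ fun L hL h0 p' hp' => ?_)
    have hle : p'.1.card ≤ t := not_lt.1 fun h => h0 (mkle_btProd_eq_zero hp' h)
    exact ⟨rowLE_Itilde htn.le hle, colLE_Jtilde htn.le ((hL.1 p' hp').1.symm.trans_le hle)⟩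

end
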